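/- arXiv:2411.18449 — 2 statements merged into one kernel-verified Lean document; each statement's English description precedes it below -/
import Mathlib

section
/- Suppose that B_∞(x,θ) > 0 for every (x,θ) ∈ 𝕋² × S¹, and let V : ℝ² → ℝ be smooth and ℤ²-periodic. Let (λ_n) be a sequence of positive reals with λ_n → +∞ and let u_n ∈ C^∞(𝕋²,L) satisfy (𝓛_α + V)u_n = λ_n² u_n and ‖u_n‖_{L²} = 1. Then for every smooth ℤ²-periodic a : ℝ² → ℂ one has ∫_{[0,1]²} a(x)|u_n(x)|² dx → ∫_{[0,1]²} a(x) dx as n → ∞. -/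
open MeasureTheory Filter Topology
open scoped Real ENNReal

noncomputable section

abbrev Pt : Type := ℝ × ℝ

/-- `v ∧ w = v₁w₂ - v₂w₁`. -/
def wedge (v w : Pt) : ℝ := v.1 * w.2 - v.2 * w.1

/-- Euclidean dot product on `ℝ²`. -/
def dotp (v w : Pt) : ℝ := v.1 * w.1 + v.2 * w.2

/-- The fundamental domain `[0,1]²` of the torus `𝕋² = ℝ²/ℤ²`. -/
def fund : Set Pt := Set.Icc (0, 0) (1, 1)

/-- `ℤ²`-periodicity of a function on `ℝ²`. -/
def IsPeriodic {E : Type*} (f : Pt → E) : Prop :=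
  ∀ (m : ℤ × ℤ) (x : Pt), f (x.1 + m.1, x.2 + m.2) = f x

/-- The magnetic translation `𝒯_m^B` associated to the flux `B0 = B̂₀`. -/
def magTrans (B0 : ℝ) (m : ℤ × ℤ) (u : Pt → ℂ) : Pt → ℂ := fun x =>
  Complex.exp (Complex.I * (B0 / 2) * (wedge ((m.1 : ℝ), (m.2 : ℝ)) x : ℝ)) *
    u (x.1 - m.1, x.2 - m.2)

/-- First partial derivative of a complex valued function on `ℝ²`. -/
def pd1 (u : Pt → ℂ) : Pt → ℂ := fun x => fderiv ℝ u x (1, 0)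

/-- Second partial derivative of a complex valued function on `ℝ²`. -/
def pd2 (u : Pt → ℂ) : Pt → ℂ := fun x => fderiv ℝ u x (0, 1)

/-- First partial derivative of a real valued function on `ℝ²`. -/
def pdR1 (f : Pt → ℝ) : Pt → ℝ := fun x => fderiv ℝ f x (1, 0)

/-- Second partial derivative of a real valued function on `ℝ²`. -/
def pdR2 (f : Pt → ℝ) : Pt → ℝ := fun x => fderiv ℝ f x (0, 1)

/-- The vector potential `A⁰(x₁,x₂) = (B̂₀/2)(−x₂, x₁)`. -/
def A0 (B0 : ℝ) : Pt → Pt := fun x => (B0 / 2 * (-x.2), B0 / 2 * x.1)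

/-- `(-i∂₁ - α₁ - A₁) u`. -/
def Dop1 (α : Pt) (A : Pt → Pt) (u : Pt → ℂ) : Pt → ℂ := fun x =>
  -Complex.I * pd1 u x - ((α.1 + (A x).1 : ℝ) : ℂ) * u x

/-- `(-i∂₂ - α₂ - A₂) u`. -/
def Dop2 (α : Pt) (A : Pt → Pt) (u : Pt → ℂ) : Pt → ℂ := fun x =>
  -Complex.I * pd2 u x - ((α.2 + (A x).2 : ℝ) : ℂ) * u x

/-- The magnetic Laplacian `𝓛_α u = (−i∂₁−α₁−A₁)²u + (−i∂₂−α₂−A₂)²u`. -/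
def magLap (α : Pt) (A : Pt → Pt) (u : Pt → ℂ) : Pt → ℂ := fun x =>
  Dop1 α A (Dop1 α A u) x + Dop2 α A (Dop2 α A u) x

/-- Membership in `C^∞(𝕋²,L)`: smooth and invariant under all magnetic translations. -/
def MemCL (B0 : ℝ) (u : Pt → ℂ) : Prop :=
  ContDiff ℝ (⊤ : ℕ∞) u ∧ ∀ m : ℤ × ℤ, magTrans B0 m u = u

end

theorem ring_lie_add {R : Type*} [Ring R] (a b c : R) : ⁅a, b + c⁆ = ⁅a, b⁆ + ⁅a, c⁆ := by
  simp only [Ring.lie_def]; noncomm_ring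

/-- A pair of symmetric operators `P`, `Q` on a pre-Hilbert space together with a commutative algebra
of bounded operators that contains the commutator of `P` and `Q` and that both normalize: the
algebraic skeleton of magnetic momenta acting on sections, with multiplication by functions. -/
structure MomentumAlgebra (E : Type*) [SeminormedAddCommGroup E] [InnerProductSpace ℂ E] where
  mult : Subalgebra ℂ (Module.End ℂ E)
  P : Module.End ℂ E
  Q : Module.End ℂ E
  mult_comm : ∀ a ∈ mult, ∀ b ∈ mult, a * b = b * a
  bounded : ∀ a ∈ mult, ∃ C : ℝ, ∀ v, ‖a v‖ ≤ C * ‖v‖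
  symmP : P.IsSymmetric
  symmQ : Q.IsSymmetric
  lieP : ∀ a ∈ mult, ⁅P, a⁆ ∈ mult
  lieQ : ∀ a ∈ mult, ⁅Q, a⁆ ∈ mult
  liePQ : ⁅P, Q⁆ ∈ mult

namespace MomentumAlgebra

variable {E : Type*} [SeminormedAddCommGroup E] [InnerProductSpace ℂ E] (S : MomentumAlgebra E)

/-- Operators of order at most `m` in the momenta. -/
def ord : ℕ → Submodule ℂ (Module.End ℂ E)
  | 0 => Subalgebra.toSubmodule S.mult
  | m + 1 => ord m ⊔ (ord m).map (LinearMap.mulLeft ℂ S.P) ⊔ (ord m).map (LinearMap.mulLeft ℂ S.Q)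

variable {S}

theorem mem_ord_succ {m : ℕ} {a : Module.End ℂ E} :
    a ∈ S.ord (m + 1) ↔
      ∃ x ∈ S.ord m, ∃ y ∈ S.ord m, ∃ z ∈ S.ord m, x + S.P * y + S.Q * z = a := by
  simp only [ord, Submodule.mem_sup, Submodule.mem_map, LinearMap.mulLeft_apply]
  constructor
  · rintro ⟨_, ⟨x, hx, _, ⟨y, hy, rfl⟩, rfl⟩, _, ⟨z, hz, rfl⟩, rfl⟩
    exact ⟨x, hx, y, hy, z, hz, rfl⟩
  · rintro ⟨x, hx, y, hy, z, hz, rfl⟩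
    exact ⟨_, ⟨x, hx, _, ⟨y, hy, rfl⟩, rfl⟩, _, ⟨z, hz, rfl⟩, rfl⟩

theorem ord_le_succ (m : ℕ) : S.ord m ≤ S.ord (m + 1) := fun a ha =>
  mem_ord_succ.2 ⟨a, ha, 0, zero_mem _, 0, zero_mem _, by simp⟩

theorem ord_mono : Monotone S.ord := monotone_nat_of_le_succ ord_le_succ

theorem P_mul_mem {m : ℕ} {a : Module.End ℂ E} (ha : a ∈ S.ord m) : S.P * a ∈ S.ord (m + 1) :=
  mem_ord_succ.2 ⟨0, zero_mem _, a, ha, 0, zero_mem _, by simp⟩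

theorem Q_mul_mem {m : ℕ} {a : Module.End ℂ E} (ha : a ∈ S.ord m) : S.Q * a ∈ S.ord (m + 1) :=
  mem_ord_succ.2 ⟨0, zero_mem _, 0, zero_mem _, a, ha, by simp⟩

/-- Induction on operators of bounded order. -/
theorem ord_induction {p : ℕ → Module.End ℂ E → Prop} (h0 : ∀ a ∈ S.mult, p 0 a)
    (hmono : ∀ m a, p m a → p (m + 1) a) (hadd : ∀ m a b, p m a → p m b → p m (a + b))
    (hP : ∀ m, ∀ a ∈ S.ord m, p m a → p (m + 1) (S.P * a))
    (hQ : ∀ m, ∀ a ∈ S.ord m, p m a → p (m + 1) (S.Q * a)) {m : ℕ} {a : Module.End ℂ E}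
    (ha : a ∈ S.ord m) : p m a := by
  induction m generalizing a with
  | zero => exact h0 a ha
  | succ m ih =>
    obtain ⟨x, hx, y, hy, z, hz, rfl⟩ := mem_ord_succ.1 ha
    exact hadd _ _ _ (hadd _ _ _ (hmono _ _ (ih hx)) (hP _ _ hy (ih hy))) (hQ _ _ hz (ih hz))

theorem mult_mul_mem {f a : Module.End ℂ E} (hf : f ∈ S.mult) {m : ℕ} (ha : a ∈ S.ord m) :
    f * a ∈ S.ord m := by
  refine ord_induction (p := fun m a => ∀ f ∈ S.mult, f * a ∈ S.ord m)
    (fun a ha f hf => S.mult.mul_mem hf ha) (fun m a h f hf => ord_le_succ _ (h f hf))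
    (fun m a b ha hb f hf => by rw [mul_add]; exact add_mem (ha f hf) (hb f hf))
    (fun m a _ h f hf => ?_) (fun m a _ h f hf => ?_) ha f hf
  · have : f * (S.P * a) = S.P * (f * a) - ⁅S.P, f⁆ * a := by rw [Ring.lie_def]; noncomm_ring
    rw [this]
    exact sub_mem (P_mul_mem (h f hf)) (ord_le_succ _ (h _ (S.lieP f hf)))
  · have : f * (S.Q * a) = S.Q * (f * a) - ⁅S.Q, f⁆ * a := by rw [Ring.lie_def]; noncomm_ring
    rw [this]
    exact sub_mem (Q_mul_mem (h f hf)) (ord_le_succ _ (h _ (S.lieQ f hf)))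

theorem mul_mem {m n : ℕ} {a b : Module.End ℂ E} (ha : a ∈ S.ord m) (hb : b ∈ S.ord n) :
    a * b ∈ S.ord (m + n) := by
  refine ord_induction (p := fun m a => a * b ∈ S.ord (m + n)) (fun a ha => ?_)
    (fun m a h => ord_mono (by omega) h)
    (fun m a c h h' => by simp only [add_mul]; exact add_mem h h')
    (fun m a _ h => ?_) (fun m a _ h => ?_) ha
  · rw [zero_add]; exact mult_mul_mem ha hb
  · rw [mul_assoc, show m + 1 + n = m + n + 1 by omega]; exact P_mul_mem h
  · rw [mul_assoc, show m + 1 + n = m + n + 1 by omega]; exact Q_mul_mem h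

theorem one_mem : (1 : Module.End ℂ E) ∈ S.ord 0 := S.mult.one_mem

theorem P_mem : S.P ∈ S.ord 1 := by simpa using P_mul_mem (S := S) one_mem

theorem Q_mem : S.Q ∈ S.ord 1 := by simpa using Q_mul_mem (S := S) one_mem

theorem P_pow_mem (j : ℕ) : S.P ^ j ∈ S.ord j := by
  induction j with
  | zero => exact one_mem
  | succ j ih => rw [pow_succ']; exact P_mul_mem ih

theorem lie_mult_mem {f a : Module.End ℂ E} (hf : f ∈ S.mult) {m : ℕ} (ha : a ∈ S.ord m) :
    ⁅f, a⁆ ∈ S.ord (m - 1) ∧ (m = 0 → ⁅f, a⁆ = 0) := by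
  refine ord_induction (p := fun m a => ⁅f, a⁆ ∈ S.ord (m - 1) ∧ (m = 0 → ⁅f, a⁆ = 0))
    (fun a ha => ?_) (fun m a h => ⟨ord_mono (by omega) h.1, by omega⟩)
    (fun m a b h h' => ⟨?_, fun hm => ?_⟩) (fun m a ha h => ⟨?_, by omega⟩)
    (fun m a ha h => ⟨?_, by omega⟩) ha
  · have : ⁅f, a⁆ = 0 := by rw [Ring.lie_def, S.mult_comm f hf a ha, sub_self]
    exact ⟨by rw [this]; exact zero_mem _, fun _ => this⟩
  · rw [ring_lie_add]; exact add_mem h.1 h'.1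
  · rw [ring_lie_add, h.2 hm, h'.2 hm, add_zero]
  · have e : ⁅f, S.P * a⁆ = S.P * ⁅f, a⁆ - ⁅S.P, f⁆ * a := by
      simp only [Ring.lie_def]; noncomm_ring
    rw [e]
    refine sub_mem ?_ (mult_mul_mem (S.lieP f hf) ha)
    rcases m with _ | m
    · rw [h.2 rfl, mul_zero]; exact zero_mem _
    · exact P_mul_mem h.1
  · have e : ⁅f, S.Q * a⁆ = S.Q * ⁅f, a⁆ - ⁅S.Q, f⁆ * a := by
      simp only [Ring.lie_def]; noncomm_ring
    rw [e]
    refine sub_mem ?_ (mult_mul_mem (S.lieQ f hf) ha)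
    rcases m with _ | m
    · rw [h.2 rfl, mul_zero]; exact zero_mem _
    · exact Q_mul_mem h.1

theorem lie_P_mem {m : ℕ} {a : Module.End ℂ E} (ha : a ∈ S.ord m) : ⁅S.P, a⁆ ∈ S.ord m := by
  refine ord_induction (p := fun m a => ⁅S.P, a⁆ ∈ S.ord m) (fun a ha => S.lieP a ha)
    (fun m a h => ord_le_succ _ h) (fun m a b h h' => by rw [ring_lie_add]; exact add_mem h h')
    (fun m a _ h => ?_) (fun m a ha h => ?_) ha
  · have e : ⁅S.P, S.P * a⁆ = S.P * ⁅S.P, a⁆ := by simp only [Ring.lie_def]; noncomm_ring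
    rw [e]; exact P_mul_mem h
  · have e : ⁅S.P, S.Q * a⁆ = S.Q * ⁅S.P, a⁆ + ⁅S.P, S.Q⁆ * a := by
      simp only [Ring.lie_def]; noncomm_ring
    rw [e]; exact add_mem (Q_mul_mem h) (ord_le_succ _ (mult_mul_mem S.liePQ ha))

theorem lie_Q_mem {m : ℕ} {a : Module.End ℂ E} (ha : a ∈ S.ord m) : ⁅S.Q, a⁆ ∈ S.ord m := by
  refine ord_induction (p := fun m a => ⁅S.Q, a⁆ ∈ S.ord m) (fun a ha => S.lieQ a ha)
    (fun m a h => ord_le_succ _ h) (fun m a b h h' => by rw [ring_lie_add]; exact add_mem h h')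
    (fun m a ha h => ?_) (fun m a _ h => ?_) ha
  · have e : ⁅S.Q, S.P * a⁆ = S.P * ⁅S.Q, a⁆ - ⁅S.P, S.Q⁆ * a := by
      simp only [Ring.lie_def]; noncomm_ring
    rw [e]; exact sub_mem (P_mul_mem h) (ord_le_succ _ (mult_mul_mem S.liePQ ha))
  · have e : ⁅S.Q, S.Q * a⁆ = S.Q * ⁅S.Q, a⁆ := by simp only [Ring.lie_def]; noncomm_ring
    rw [e]; exact Q_mul_mem h

theorem lie_mem {m n : ℕ} {a b : Module.End ℂ E} (ha : a ∈ S.ord (m + 1)) (hb : b ∈ S.ord n) :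
    ⁅a, b⁆ ∈ S.ord (m + n) := by
  induction m generalizing a with
  | zero =>
    obtain ⟨x, hx, y, hy, z, hz, rfl⟩ := mem_ord_succ.1 ha
    have e : ⁅x + S.P * y + S.Q * z, b⁆ = ⁅x, b⁆ + (S.P * ⁅y, b⁆ + ⁅S.P, b⁆ * y)
        + (S.Q * ⁅z, b⁆ + ⁅S.Q, b⁆ * z) := by
      simp only [Ring.lie_def]; noncomm_ring
    have h0 : ∀ f ∈ S.mult, ∀ c : Module.End ℂ E,
        (∀ k, ∀ d ∈ S.ord k, c * d ∈ S.ord (k + 1)) → c * ⁅f, b⁆ ∈ S.ord (0 + n) := by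
      intro f hf c hc
      rcases n with _ | n
      · rw [(lie_mult_mem hf hb).2 rfl, mul_zero]; exact zero_mem _
      · simpa using hc _ _ (lie_mult_mem hf hb).1
    rw [e]
    refine add_mem (add_mem (ord_mono (by omega) (lie_mult_mem hx hb).1)
      (add_mem (h0 y hy _ fun k d hd => P_mul_mem hd) ?_))
      (add_mem (h0 z hz _ fun k d hd => Q_mul_mem hd) ?_)
    · rw [add_comm]; exact mul_mem (lie_P_mem hb) hy
    · rw [add_comm]; exact mul_mem (lie_Q_mem hb) hz
  | succ m ih =>
    obtain ⟨x, hx, y, hy, z, hz, rfl⟩ := mem_ord_succ.1 ha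
    have e : ⁅x + S.P * y + S.Q * z, b⁆ = ⁅x, b⁆ + (S.P * ⁅y, b⁆ + ⁅S.P, b⁆ * y)
        + (S.Q * ⁅z, b⁆ + ⁅S.Q, b⁆ * z) := by
      simp only [Ring.lie_def]; noncomm_ring
    rw [e, show m + 1 + n = m + n + 1 by omega]
    refine add_mem (add_mem (ord_le_succ _ (ih hx)) (add_mem (P_mul_mem (ih hy)) ?_))
      (add_mem (Q_mul_mem (ih hz)) ?_)
    · exact ord_mono (by omega) (mul_mem (lie_P_mem hb) hy)
    · exact ord_mono (by omega) (mul_mem (lie_Q_mem hb) hz)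

variable (S) in
/-- The Laplacian `P² + Q²`. -/
def lap : Module.End ℂ E := S.P * S.P + S.Q * S.Q

theorem lie_lap (a : Module.End ℂ E) :
    ⁅S.lap, a⁆ = 2 • (S.P * ⁅S.P, a⁆) + 2 • (S.Q * ⁅S.Q, a⁆) - ⁅S.P, ⁅S.P, a⁆⁆ - ⁅S.Q, ⁅S.Q, a⁆⁆ := by
  simp only [Ring.lie_def, lap]; noncomm_ring

theorem lie_lap_P_mem : ⁅S.lap, S.P⁆ ∈ S.ord 1 := by
  have e : ⁅S.lap, S.P⁆ = -(S.Q * ⁅S.P, S.Q⁆) - ⁅S.P, S.Q⁆ * S.Q := by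
    simp only [Ring.lie_def, lap]; noncomm_ring
  rw [e]
  exact sub_mem (neg_mem (Q_mul_mem S.liePQ)) (mult_mul_mem S.liePQ Q_mem)

theorem lie_lap_Q_mem : ⁅S.lap, S.Q⁆ ∈ S.ord 1 := by
  have e : ⁅S.lap, S.Q⁆ = S.P * ⁅S.P, S.Q⁆ + ⁅S.P, S.Q⁆ * S.P := by
    simp only [Ring.lie_def, lap]; noncomm_ring
  rw [e]
  exact add_mem (P_mul_mem S.liePQ) (mult_mul_mem S.liePQ P_mem)

theorem lie_lap_mul (a b : Module.End ℂ E) :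
    ⁅S.lap, a * b⁆ = ⁅S.lap, a⁆ * b + a * ⁅S.lap, b⁆ := by
  simp only [Ring.lie_def]; noncomm_ring

theorem lie_lap_P_pow_mem (j : ℕ) : ⁅S.lap, S.P ^ j⁆ ∈ S.ord j := by
  induction j with
  | zero => rw [pow_zero, Ring.lie_def, mul_one, one_mul, sub_self]; exact zero_mem _
  | succ j ih =>
    rw [pow_succ', lie_lap_mul]
    exact add_mem (ord_mono (by omega) (mul_mem lie_lap_P_mem (P_pow_mem j))) (P_mul_mem ih)

end MomentumAlgebra

/-- Eigenvectors of `P² + Q² + W` with eigenvalues `lam n ^ 2 → ∞`, where `W` is a symmetric element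
of the multiplication algebra. -/
structure EigenSequence {E : Type*} [SeminormedAddCommGroup E] [InnerProductSpace ℂ E]
    (S : MomentumAlgebra E) where
  W : Module.End ℂ E
  W_mem : W ∈ S.mult
  W_symm : W.IsSymmetric
  lam : ℕ → ℝ
  lam_tendsto : Tendsto lam atTop atTop
  u : ℕ → E
  norm_u : ∀ n, ‖u n‖ = 1
  eigen : ∀ n, S.lap (u n) + W (u n) = ((lam n : ℂ) ^ 2) • u n

namespace EigenSequence

open MomentumAlgebra

variable {E : Type*} [SeminormedAddCommGroup E] [InnerProductSpace ℂ E] {S : MomentumAlgebra E}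
  (q : EigenSequence S)

theorem lap_u (n : ℕ) : S.lap (q.u n) = ((q.lam n : ℂ) ^ 2) • q.u n - q.W (q.u n) :=
  eq_sub_of_add_eq (q.eigen n)

theorem norm_sq_add_norm_sq (w : E) :
    ‖S.P w‖ ^ 2 + ‖S.Q w‖ ^ 2 = (inner ℂ w (S.lap w)).re := by
  have h1 : (inner ℂ w (S.P (S.P w))) = inner ℂ (S.P w) (S.P w) := (S.symmP _ _).symm
  have h2 : (inner ℂ w (S.Q (S.Q w))) = inner ℂ (S.Q w) (S.Q w) := (S.symmQ _ _).symm
  simp only [lap, LinearMap.add_apply, Module.End.mul_apply, inner_add_right, h1, h2,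
    inner_self_eq_norm_sq_to_K, Complex.add_re]
  norm_cast

theorem re_inner_le {x y : E} {c d : ℝ} (hx : ‖x‖ ≤ c) (hy : ‖y‖ ≤ d) :
    (inner ℂ x y).re ≤ c * d :=
  (Complex.re_le_norm _).trans <| (norm_inner_le_norm x y).trans <|
    mul_le_mul hx hy (norm_nonneg _) ((norm_nonneg _).trans hx)

theorem sq_add_sq_le_of_le {X Y K R l : ℝ} (hK : 0 ≤ K) (hR : R ^ 2 ≤ l ^ 2 * R ^ 2)
    (h : X ^ 2 + Y ^ 2 ≤ K * (l ^ 2 * R ^ 2) + 2 * (K * (X * R)) + 2 * (K * (Y * R))) :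
    X ^ 2 + Y ^ 2 ≤ ((1 + 4 * K) * (R * l)) ^ 2 := by
  have h1 : K ^ 2 * R ^ 2 ≤ K ^ 2 * (l ^ 2 * R ^ 2) := by gcongr
  have h2 : 0 ≤ l ^ 2 * R ^ 2 := by positivity
  linarith [sq_nonneg (X - 2 * (K * R)), sq_nonneg (Y - 2 * (K * R)), mul_nonneg hK h2,
    mul_nonneg (sq_nonneg K) h2]

/-- Operators of order `m` have size `O(lam ^ m)` on the eigenvectors. -/
theorem exists_bound {m : ℕ} {a : Module.End ℂ E} (ha : a ∈ S.ord m) :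
    ∃ C : ℝ, 0 ≤ C ∧ ∀ n, 1 ≤ q.lam n → ‖a (q.u n)‖ ≤ C * q.lam n ^ m := by
  induction m generalizing a with
  | zero =>
    obtain ⟨C, hC⟩ := S.bounded a ha
    refine ⟨|C|, abs_nonneg _, fun n _ => (hC _).trans ?_⟩
    rw [q.norm_u, mul_one, pow_zero, mul_one]
    exact le_abs_self _
  | succ m ih =>
    have key : ∀ a ∈ S.ord m, ∃ C : ℝ, 0 ≤ C ∧ ∀ n, 1 ≤ q.lam n →
        ‖S.P (a (q.u n))‖ ≤ C * q.lam n ^ (m + 1) ∧ ‖S.Q (a (q.u n))‖ ≤ C * q.lam n ^ (m + 1) := by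
      intro a ha
      obtain ⟨C0, h00, h0⟩ := ih ha
      obtain ⟨C1, h10, h1⟩ := ih (lie_P_mem ha)
      obtain ⟨C2, h20, h2⟩ := ih (lie_Q_mem ha)
      obtain ⟨C3, h30, h3⟩ := ih (lie_P_mem (lie_P_mem ha))
      obtain ⟨C4, h40, h4⟩ := ih (lie_Q_mem (lie_Q_mem ha))
      obtain ⟨C5, h50, h5⟩ := ih (mul_mem (m := m) (n := 0) ha q.W_mem)
      set K := C0 * C0 + C0 * C5 + C0 * C3 + C0 * C4 + C1 + C2 with hK
      have hK0 : 0 ≤ K := by positivity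
      refine ⟨1 + 4 * K, by positivity, fun n hn => ?_⟩
      specialize h0 n hn; specialize h1 n hn; specialize h2 n hn
      specialize h3 n hn; specialize h4 n hn; specialize h5 n hn
      set l := q.lam n
      set R := l ^ m
      have hR : 0 ≤ R := by positivity
      have hl : 1 ≤ l ^ 2 := one_le_pow₀ hn
      set w := a (q.u n) with hw
      set X := ‖S.P w‖
      set Y := ‖S.Q w‖
      have e : S.lap w = ((l : ℂ) ^ 2) • w - (a * q.W) (q.u n) + (2 : ℂ) • S.P (⁅S.P, a⁆ (q.u n))
          + (2 : ℂ) • S.Q (⁅S.Q, a⁆ (q.u n)) - ⁅S.P, ⁅S.P, a⁆⁆ (q.u n)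
          - ⁅S.Q, ⁅S.Q, a⁆⁆ (q.u n) := by
        have h := congrArg (fun f : Module.End ℂ E => f (q.u n)) (lie_lap (S := S) a)
        simp only [Ring.lie_def S.lap, LinearMap.sub_apply, LinearMap.add_apply,
          Module.End.mul_apply, LinearMap.smul_apply, q.lap_u, map_sub, map_smul] at h
        rw [sub_eq_iff_eq_add] at h
        rw [hw, h]
        simp only [Module.End.mul_apply, two_smul]
        abel
      have hsq := norm_sq_add_norm_sq (S := S) w
      have hPw : ‖S.P w‖ ≤ X := le_rfl
      have hQw : ‖S.Q w‖ ≤ Y := le_rfl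
      have b1 : (inner ℂ w (((l : ℂ) ^ 2) • w)).re ≤ l ^ 2 * (C0 * R * (C0 * R)) := by
        rw [inner_smul_right, ← Complex.ofReal_pow, Complex.re_ofReal_mul]
        exact mul_le_mul_of_nonneg_left (re_inner_le h0 h0) (by positivity)
      have b2 : -(inner ℂ w ((a * q.W) (q.u n))).re ≤ C0 * R * (C5 * R) := by
        rw [← Complex.neg_re, ← inner_neg_right]
        exact re_inner_le h0 (by rwa [norm_neg])
      have b3 : (inner ℂ w ((2 : ℂ) • S.P (⁅S.P, a⁆ (q.u n)))).re ≤ 2 * (X * (C1 * R)) := by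
        rw [inner_smul_right, ← S.symmP, show (2 : ℂ) = ((2 : ℝ) : ℂ) by norm_num,
          Complex.re_ofReal_mul]
        exact mul_le_mul_of_nonneg_left (re_inner_le hPw h1) (by positivity)
      have b4 : (inner ℂ w ((2 : ℂ) • S.Q (⁅S.Q, a⁆ (q.u n)))).re ≤ 2 * (Y * (C2 * R)) := by
        rw [inner_smul_right, ← S.symmQ, show (2 : ℂ) = ((2 : ℝ) : ℂ) by norm_num,
          Complex.re_ofReal_mul]
        exact mul_le_mul_of_nonneg_left (re_inner_le hQw h2) (by positivity)
      have b5 : -(inner ℂ w (⁅S.P, ⁅S.P, a⁆⁆ (q.u n))).re ≤ C0 * R * (C3 * R) := by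
        rw [← Complex.neg_re, ← inner_neg_right]
        exact re_inner_le h0 (by rwa [norm_neg])
      have b6 : -(inner ℂ w (⁅S.Q, ⁅S.Q, a⁆⁆ (q.u n))).re ≤ C0 * R * (C4 * R) := by
        rw [← Complex.neg_re, ← inner_neg_right]
        exact re_inner_le h0 (by rwa [norm_neg])
      rw [e] at hsq
      simp only [inner_add_right, inner_sub_right, Complex.add_re, Complex.sub_re] at hsq
      have hX : 0 ≤ X := norm_nonneg _
      have hY : 0 ≤ Y := norm_nonneg _
      have hR2 : R ^ 2 ≤ l ^ 2 * R ^ 2 := le_mul_of_one_le_left (by positivity) hl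
      have c1 : C1 * (X * R) ≤ K * (X * R) := by
        gcongr; rw [hK]; linarith [mul_nonneg h00 h00, mul_nonneg h00 h50, mul_nonneg h00 h30,
          mul_nonneg h00 h40]
      have c2 : C2 * (Y * R) ≤ K * (Y * R) := by
        gcongr; rw [hK]; linarith [mul_nonneg h00 h00, mul_nonneg h00 h50, mul_nonneg h00 h30,
          mul_nonneg h00 h40]
      have c3 : (C0 * C5 + C0 * C3 + C0 * C4) * R ^ 2
          ≤ (C0 * C5 + C0 * C3 + C0 * C4) * (l ^ 2 * R ^ 2) := by gcongr
      have c4 : (C0 * C0 + C0 * C5 + C0 * C3 + C0 * C4) * (l ^ 2 * R ^ 2)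
          ≤ K * (l ^ 2 * R ^ 2) := by
        gcongr; rw [hK]; linarith
      have hfin : X ^ 2 + Y ^ 2 ≤ K * (l ^ 2 * R ^ 2) + 2 * (K * (X * R)) + 2 * (K * (Y * R)) := by
        linarith [mul_le_mul_of_nonneg_left hR2 (mul_nonneg h00 h00)]
      have hfin2 := sq_add_sq_le_of_le hK0 hR2 hfin
      rw [pow_succ]
      have hnn : 0 ≤ (1 + 4 * K) * (R * l) := by positivity
      exact ⟨(le_abs_self X).trans (abs_le_of_sq_le_sq (by linarith [sq_nonneg Y]) hnn),
        (le_abs_self Y).trans (abs_le_of_sq_le_sq (by linarith [sq_nonneg X]) hnn)⟩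
    obtain ⟨x, hx, y, hy, z, hz, rfl⟩ := mem_ord_succ.1 ha
    obtain ⟨C0, h00, h0⟩ := ih hx
    obtain ⟨C1, h10, h1⟩ := key y hy
    obtain ⟨C2, h20, h2⟩ := key z hz
    refine ⟨C0 + C1 + C2, by positivity, fun n hn => ?_⟩
    have t : C0 * q.lam n ^ m ≤ C0 * q.lam n ^ (m + 1) := by
      exact mul_le_mul_of_nonneg_left (pow_le_pow_right₀ hn m.le_succ) h00
    calc ‖(x + S.P * y + S.Q * z) (q.u n)‖
        ≤ ‖x (q.u n)‖ + ‖S.P (y (q.u n))‖ + ‖S.Q (z (q.u n))‖ := norm_add₃_le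
      _ ≤ (C0 + C1 + C2) * q.lam n ^ (m + 1) := by
        linarith [h0 n hn, (h1 n hn).1, (h2 n hn).2]

/-- Matrix element of `a` on the `n`-th eigenvector, in units of `lam ^ m`. -/
noncomputable def expect (m : ℕ) (a : Module.End ℂ E) (n : ℕ) : ℂ :=
  inner ℂ (q.u n) (a (q.u n)) / (q.lam n : ℂ) ^ m

theorem expect_add (m : ℕ) (a b : Module.End ℂ E) :
    q.expect m (a + b) = q.expect m a + q.expect m b := by
  ext n; simp [expect, inner_add_right, add_div]

theorem expect_sub (m : ℕ) (a b : Module.End ℂ E) :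
    q.expect m (a - b) = q.expect m a - q.expect m b := by
  ext n; simp [expect, inner_sub_right, sub_div]

theorem expect_smul (m : ℕ) (c : ℂ) (a : Module.End ℂ E) :
    q.expect m (c • a) = c • q.expect m a := by
  ext n; simp [expect, inner_smul_right, mul_div_assoc]

/-- Operators whose matrix elements are `o(lam ^ m)` along the filter `l`. -/
noncomputable def null (l : Filter ℕ) (m : ℕ) : Submodule ℂ (Module.End ℂ E) where
  carrier := {a | Tendsto (q.expect m a) l (𝓝 0)}
  add_mem' {a b} ha hb := by
    have h := Tendsto.add (f := q.expect m a) (g := q.expect m b) ha hb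
    rw [add_zero] at h
    rw [Set.mem_ofPred_eq, expect_add]
    exact h
  zero_mem' := by
    have : q.expect m 0 = fun _ => 0 := by ext n; simp [expect]
    simp only [Set.mem_ofPred_eq, this, tendsto_const_nhds]
  smul_mem' c a ha := by
    have h := Tendsto.const_smul (f := q.expect m a) ha c
    rw [smul_zero] at h
    rw [Set.mem_ofPred_eq, expect_smul]
    exact h

variable {q} {l : Filter ℕ}

theorem mem_null {m : ℕ} {a : Module.End ℂ E} :
    a ∈ q.null l m ↔ Tendsto (q.expect m a) l (𝓝 0) := Iff.rfl

theorem tendsto_expect_of_sub_mem {m : ℕ} {a b : Module.End ℂ E} (h : a - b ∈ q.null l m) {z : ℂ}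
    (hb : Tendsto (q.expect m b) l (𝓝 z)) : Tendsto (q.expect m a) l (𝓝 z) := by
  rw [mem_null, expect_sub] at h
  simpa using h.add hb

variable (q)

theorem eventually_one_le (hl : l ≤ atTop) : ∀ᶠ n in l, 1 ≤ q.lam n :=
  hl (q.lam_tendsto.eventually_ge_atTop 1)

theorem norm_inner_u_le (n : ℕ) (x : E) : ‖inner ℂ (q.u n) x‖ ≤ ‖x‖ := by
  simpa [q.norm_u] using norm_inner_le_norm (𝕜 := ℂ) (q.u n) x

theorem exists_expect_bound {m : ℕ} {a : Module.End ℂ E} (ha : a ∈ S.ord m) :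
    ∃ C : ℝ, ∀ n, 1 ≤ q.lam n → ‖q.expect m a n‖ ≤ C := by
  obtain ⟨C, hC, h⟩ := q.exists_bound ha
  refine ⟨C, fun n hn => ?_⟩
  have hl : 0 < q.lam n := by linarith
  rw [expect, norm_div, norm_pow, Complex.norm_real, Real.norm_of_nonneg hl.le,
    div_le_iff₀ (by positivity)]
  exact (q.norm_inner_u_le n _).trans (h n hn)

theorem expect_succ (m : ℕ) (a : Module.End ℂ E) (n : ℕ) :
    q.expect (m + 1) a n = q.expect m a n * (q.lam n : ℂ)⁻¹ := by
  rw [expect, expect, pow_succ, div_mul_eq_div_div, div_eq_mul_inv]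

theorem tendsto_inv_lam (hl : l ≤ atTop) : Tendsto (fun n => (q.lam n : ℂ)⁻¹) l (𝓝 0) := by
  have h := (tendsto_inv_atTop_zero.comp q.lam_tendsto).mono_left hl
  have h2 := (Complex.continuous_ofReal.tendsto 0).comp h
  simpa [Function.comp_def] using h2

theorem ord_le_null (hl : l ≤ atTop) (m : ℕ) : S.ord m ≤ q.null l (m + 1) := by
  intro a ha
  obtain ⟨C, hC⟩ := q.exists_expect_bound ha
  rw [mem_null, funext (q.expect_succ m a)]
  refine isBoundedUnder_le_mul_tendsto_zero ⟨C, ?_⟩ (q.tendsto_inv_lam hl)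
  rw [eventually_map]
  filter_upwards [q.eventually_one_le hl] with n hn using hC n hn

theorem null_le_succ (hl : l ≤ atTop) (m : ℕ) : q.null l m ≤ q.null l (m + 1) := by
  intro a ha
  rw [mem_null] at ha ⊢
  rw [funext (q.expect_succ m a)]
  simpa using ha.mul (q.tendsto_inv_lam hl)

theorem lap_symm (x y : E) : inner ℂ (S.lap x) y = inner ℂ x (S.lap y) := by
  simp only [lap, LinearMap.add_apply, Module.End.mul_apply, inner_add_left, inner_add_right]
  rw [S.symmP, S.symmP, S.symmQ, S.symmQ]

theorem lie_lap_mem_null (hl : l ≤ atTop) {m : ℕ} {a : Module.End ℂ E} (ha : a ∈ S.ord m) :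
    ⁅S.lap, a⁆ ∈ q.null l m := by
  have e : q.expect m ⁅S.lap, a⁆ = q.expect m (-⁅q.W, a⁆) := by
    ext n
    have h : inner ℂ (q.u n) (⁅S.lap, a⁆ (q.u n)) = inner ℂ (q.u n) ((-⁅q.W, a⁆) (q.u n)) := by
      simp only [Ring.lie_def, LinearMap.sub_apply, LinearMap.neg_apply, Module.End.mul_apply,
        inner_sub_right, inner_neg_right]
      rw [← lap_symm, q.lap_u, map_sub, map_smul, inner_sub_left, inner_sub_right,
        inner_smul_left, inner_smul_right, q.W_symm, ← Complex.ofReal_pow, Complex.conj_ofReal]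
      ring
    rw [expect, h, expect]
  rw [mem_null, e, ← mem_null]
  refine neg_mem ?_
  obtain ⟨h, h0⟩ := lie_mult_mem q.W_mem ha
  rcases m with _ | m
  · rw [h0 rfl]; exact zero_mem _
  · exact q.ord_le_null hl m h

theorem tendsto_expect_mul_lap (hl : l ≤ atTop) {m : ℕ} {a : Module.End ℂ E} (ha : a ∈ S.ord m)
    {z : ℂ} (h : Tendsto (q.expect m a) l (𝓝 z)) :
    Tendsto (q.expect (m + 2) (a * S.lap)) l (𝓝 z) := by
  have haW : a * q.W ∈ q.null l (m + 2) :=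
    q.null_le_succ hl _ (q.ord_le_null hl m (mul_mem (n := 0) ha q.W_mem))
  have h2 := h.sub (mem_null.1 haW)
  rw [sub_zero] at h2
  refine h2.congr' ?_
  filter_upwards [q.eventually_one_le hl] with n hn
  have hn0 : (q.lam n : ℂ) ≠ 0 := by
    have : q.lam n ≠ 0 := by linarith
    exact_mod_cast this
  simp only [expect, Module.End.mul_apply, q.lap_u, map_sub, map_smul, inner_sub_right,
    inner_smul_right]
  field_simp
  ring

theorem exists_tendsto_expect {l : Ultrafilter ℕ} (hl : ↑l ≤ (atTop : Filter ℕ)) {m : ℕ}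
    {a : Module.End ℂ E} (ha : a ∈ S.ord m) :
    ∃ z, Tendsto (q.expect m a) l (𝓝 z) := by
  obtain ⟨C, hC⟩ := q.exists_expect_bound ha
  obtain ⟨z, -, hz⟩ := (isCompact_closedBall (0 : ℂ) C).ultrafilter_le_nhds
    (l.map (q.expect m a)) (by
      rw [Ultrafilter.coe_map, le_principal_iff, Filter.mem_map]
      filter_upwards [q.eventually_one_le hl] with n hn
      simpa using hC n hn)
  exact ⟨z, hz⟩

theorem exists_lie_lap_P_pow (j : ℕ) : ∃ r ∈ S.ord j,
    ⁅S.lap, S.P ^ (j + 1)⁆ = r - (2 * (j + 1) : ℂ) • (⁅S.P, S.Q⁆ * (S.Q * S.P ^ j)) := by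
  set k := ⁅S.P, S.Q⁆ with hk
  have hlap : ⁅S.lap, S.P⁆ = -(2 : ℂ) • (k * S.Q) - ⁅S.Q, k⁆ := by
    have h : ⁅S.lap, S.P⁆ = -(S.Q * k) - k * S.Q := by
      rw [hk]; simp only [Ring.lie_def, lap]; noncomm_ring
    rw [h, Ring.lie_def S.Q k]
    module
  have hPk : S.P * k = k * S.P + ⁅S.P, k⁆ := by rw [Ring.lie_def S.P k]; abel
  have hPQ : S.P * S.Q = S.Q * S.P + k := by rw [hk, Ring.lie_def]; abel
  induction j with
  | zero =>
    refine ⟨-⁅S.Q, k⁆, neg_mem (S.lieQ _ S.liePQ), ?_⟩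
    rw [pow_one, hlap, pow_zero, mul_one]
    push_cast
    module
  | succ j ih =>
    obtain ⟨r, hr, h⟩ := ih
    refine ⟨-(⁅S.Q, k⁆ * S.P ^ (j + 1)) + S.P * r
      - (2 * (j + 1) : ℂ) • (k * (k * S.P ^ j) + ⁅S.P, k⁆ * (S.Q * S.P ^ j)), ?_, ?_⟩
    · have hX := P_pow_mem (S := S) j
      refine sub_mem (add_mem (neg_mem ?_) (P_mul_mem hr)) (Submodule.smul_mem _ _ (add_mem ?_ ?_))
      · exact mult_mul_mem (S.lieQ _ S.liePQ) (P_pow_mem _)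
      · exact ord_le_succ _ (mult_mul_mem S.liePQ (mult_mul_mem S.liePQ hX))
      · exact mult_mul_mem (S.lieP _ S.liePQ) (Q_mul_mem hX)
    · have e : S.P * (k * (S.Q * S.P ^ j)) = k * (S.Q * S.P ^ (j + 1)) + k * (k * S.P ^ j)
          + ⁅S.P, k⁆ * (S.Q * S.P ^ j) := by
        rw [← mul_assoc, hPk, add_mul, mul_assoc k S.P, ← mul_assoc S.P S.Q, hPQ, add_mul,
          mul_assoc S.Q, ← pow_succ', mul_add]
      rw [pow_succ' S.P (j + 1), lie_lap_mul, h, hlap, mul_sub, mul_smul_comm, e]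
      simp only [sub_mul, smul_mul_assoc, mul_assoc]
      push_cast
      module

theorem lap_mul_eq (X : Module.End ℂ E) :
    S.Q * (S.Q * X) = X * S.lap + ⁅S.lap, X⁆ - S.P * (S.P * X) := by
  simp only [Ring.lie_def, lap]; noncomm_ring

/-- Drift in the angular variable, tested against powers of `P`. -/
theorem curvature_recursion (hl : l ≤ atTop) (N : ℕ) :
    (2 * N + 2 : ℂ) • (⁅S.P, S.Q⁆ * S.P ^ (2 * N + 2))
      - (2 * N + 1 : ℂ) • (⁅S.P, S.Q⁆ * S.P ^ (2 * N) * S.lap) ∈ q.null l (2 * N + 2) := by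
  obtain ⟨r, hr, h⟩ := exists_lie_lap_P_pow (S := S) (2 * N)
  set k := ⁅S.P, S.Q⁆ with hk
  set X := S.P ^ (2 * N) with hX
  have hXm : X ∈ S.ord (2 * N) := P_pow_mem _
  have h1 : S.P ^ (2 * N + 1) = S.P * X := pow_succ' _ _
  have h2 : S.P ^ (2 * N + 2) = S.P * (S.P * X) := by rw [← h1, ← pow_succ']
  have hA := q.lie_lap_mem_null hl (Q_mul_mem (P_pow_mem (S := S) (2 * N + 1)))
  have hlQ : ⁅S.lap, S.Q⁆ = (2 : ℂ) • (k * S.P) + ⁅S.P, k⁆ := by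
    have h : ⁅S.lap, S.Q⁆ = S.P * k + k * S.P := by
      rw [hk]; simp only [Ring.lie_def, lap]; noncomm_ring
    rw [h, Ring.lie_def S.P k]
    module
  have hQk : S.Q * (k * (S.Q * X)) = k * (S.Q * (S.Q * X)) + ⁅S.Q, k⁆ * (S.Q * X) := by
    rw [Ring.lie_def]; noncomm_ring
  have hrem : ⁅S.P, k⁆ * (S.P * X) + S.Q * r - (2 * (2 * N + 1) : ℂ) •
      (k * ⁅S.lap, X⁆ + ⁅S.Q, k⁆ * (S.Q * X)) ∈ q.null l (2 * N + 2) := by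
    refine q.ord_le_null hl (2 * N + 1) (sub_mem (add_mem ?_ (Q_mul_mem hr))
      (Submodule.smul_mem _ _ (add_mem ?_ ?_)))
    · exact mult_mul_mem (S.lieP _ S.liePQ) (P_mul_mem hXm)
    · exact ord_le_succ _ (mult_mul_mem S.liePQ (lie_lap_P_pow_mem _))
    · exact mult_mul_mem (S.lieQ _ S.liePQ) (Q_mul_mem hXm)
  convert Submodule.smul_mem _ (2⁻¹ : ℂ) (sub_mem hA hrem) using 1
  rw [lie_lap_mul, h, hlQ, h1, h2, mul_sub, mul_smul_comm, hQk, lap_mul_eq X]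
  simp only [add_mul, mul_sub, mul_add, smul_mul_assoc, mul_assoc]
  push_cast
  module

/-- Invariance under the flow, tested against a multiplication operator commuting with `P` that is
an eigenvector of the adjoint action of `Q`. -/
theorem mul_pow_recursion (hl : l ≤ atTop) {e : Module.End ℂ E} {c : ℂ} (he : e ∈ S.mult)
    (hPe : ⁅S.P, e⁆ = 0) (hQe : ⁅S.Q, e⁆ = c • e) (hc : c ≠ 0) (N : ℕ) :
    e * S.P ^ (2 * N) * S.lap - e * S.P ^ (2 * N + 2) ∈ q.null l (2 * N + 2) := by
  set X := S.P ^ (2 * N) with hX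
  have hXm : X ∈ S.ord (2 * N) := P_pow_mem _
  have h2 : S.P ^ (2 * N + 2) = S.P * (S.P * X) := by rw [pow_succ', pow_succ']
  have hA := q.null_le_succ hl _ (q.lie_lap_mem_null hl (mult_mul_mem he (Q_mul_mem hXm)))
  have hle : ⁅S.lap, e⁆ = (2 * c) • (e * S.Q) + (c * c) • e := by
    have hQ : S.Q * e = e * S.Q + c • e := by rw [← hQe, Ring.lie_def]; abel
    rw [lie_lap, hPe, hQe, Ring.lie_def S.Q (c • e), mul_smul_comm, hQ, Ring.lie_def S.P 0]
    simp only [mul_zero, zero_mul, smul_mul_assoc]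
    module
  have hrem : (c * c) • (e * (S.Q * X)) + e * (⁅S.lap, S.Q⁆ * X) + e * (S.Q * ⁅S.lap, X⁆)
      + (2 * c) • (e * ⁅S.lap, X⁆) ∈ q.null l (2 * N + 2) := by
    refine q.ord_le_null hl (2 * N + 1) (add_mem (add_mem (add_mem ?_ ?_) ?_) ?_)
    · exact Submodule.smul_mem _ _ (mult_mul_mem he (Q_mul_mem hXm))
    · exact mult_mul_mem he (ord_mono (by omega) (mul_mem lie_lap_Q_mem hXm))
    · exact mult_mul_mem he (Q_mul_mem (lie_lap_P_pow_mem _))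
    · exact Submodule.smul_mem _ _ (ord_le_succ _ (mult_mul_mem he (lie_lap_P_pow_mem _)))
  convert Submodule.smul_mem _ (2 * c)⁻¹ (sub_mem hA hrem) using 1
  rw [lie_lap_mul, hle, lie_lap_mul, h2]
  simp only [add_mul, mul_add, smul_mul_assoc, mul_assoc, lap_mul_eq X, mul_sub]
  rw [eq_inv_smul_iff₀ (by simpa using hc)]
  module

/-- Invariance under the flow, tested against `g * P ^ (2 * N + 1)`. -/
theorem lie_P_recursion (hl : l ≤ atTop) {g : Module.End ℂ E} (hg : g ∈ S.mult) (N : ℕ) :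
    ⁅S.P, g⁆ * S.P ^ (2 * N + 2) - (-(S.P ^ (N + 1) * (⁅S.Q, g⁆ * (S.Q * S.P ^ N))))
      ∈ q.null l (2 * N + 2) := by
  set f := ⁅S.Q, g⁆ with hf
  have hfm : f ∈ S.mult := S.lieQ _ hg
  have hYm := P_pow_mem (S := S) (2 * N + 1)
  have h2 : S.P ^ (2 * N + 2) = S.P * S.P ^ (2 * N + 1) := pow_succ' _ _
  have h3 : S.P ^ (2 * N + 1) = S.P ^ N * S.P ^ (N + 1) := by rw [← pow_add]; congr 1; omega
  have hA := q.null_le_succ hl _ (q.lie_lap_mem_null hl (mult_mul_mem hg hYm))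
  have hlg : ⁅S.lap, g⁆ = (2 : ℂ) • (⁅S.P, g⁆ * S.P) + (2 : ℂ) • (f * S.Q)
      + (⁅S.P, ⁅S.P, g⁆⁆ + ⁅S.Q, f⁆) := by
    rw [lie_lap, ← hf, Ring.lie_def S.P ⁅S.P, g⁆, Ring.lie_def S.Q f]
    module
  have hcom : ⁅S.P ^ (N + 1), f * (S.Q * S.P ^ N)⁆ ∈ q.null l (2 * N + 2) := by
    refine q.ord_le_null hl (2 * N + 1) (ord_mono (by omega) (lie_mem (m := N) (P_pow_mem _)
      (mult_mul_mem hfm (Q_mul_mem (P_pow_mem N)))))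
  have hrem : (⁅S.P, ⁅S.P, g⁆⁆ + ⁅S.Q, f⁆) * S.P ^ (2 * N + 1) + g * ⁅S.lap, S.P ^ (2 * N + 1)⁆
      ∈ q.null l (2 * N + 2) := by
    refine q.ord_le_null hl (2 * N + 1) (add_mem (mult_mul_mem ?_ hYm)
      (mult_mul_mem hg (lie_lap_P_pow_mem _)))
    exact add_mem (S.lieP _ (S.lieP _ hg)) (S.lieQ _ hfm)
  convert add_mem (Submodule.smul_mem _ (2⁻¹ : ℂ) (sub_mem hA hrem)) hcom using 1
  rw [lie_lap_mul, hlg, h2, Ring.lie_def (S.P ^ (N + 1)), h3]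
  simp only [add_mul, smul_mul_assoc, mul_assoc]
  module

/-- The mass of `P ^ N` on the eigenvectors, in units of `lam ^ (2 * N)`. -/
noncomputable def mass (N n : ℕ) : ℝ := ‖(S.P ^ N) (q.u n)‖ ^ 2 / q.lam n ^ (2 * N)

/-- The mass of `Q * P ^ N` on the eigenvectors, in units of `lam ^ (2 * N + 2)`. -/
noncomputable def transMass (N n : ℕ) : ℝ :=
  ‖S.Q ((S.P ^ N) (q.u n))‖ ^ 2 / q.lam n ^ (2 * N + 2)

theorem symm_P_pow (N : ℕ) : (S.P ^ N).IsSymmetric := S.symmP.pow N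

theorem mass_eq (N n : ℕ) : q.mass N n = (q.expect (2 * N) (S.P ^ (2 * N)) n).re := by
  have h : inner ℂ (q.u n) ((S.P ^ (2 * N)) (q.u n))
      = inner ℂ ((S.P ^ N) (q.u n)) ((S.P ^ N) (q.u n)) := by
    rw [two_mul, pow_add, Module.End.mul_apply, ← symm_P_pow]
  rw [expect, mass, h, inner_self_eq_norm_sq_to_K]
  norm_cast
  rw [Complex.div_ofReal_re]
  rfl

theorem mass_add_transMass (N n : ℕ) :
    q.mass (N + 1) n + q.transMass N n
      = (q.expect (2 * N + 2) (S.P ^ N * (S.lap * S.P ^ N)) n).re := by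
  have h : inner ℂ ((S.P ^ N) (q.u n)) (S.lap ((S.P ^ N) (q.u n)))
      = inner ℂ (q.u n) ((S.P ^ N * (S.lap * S.P ^ N)) (q.u n)) := by
    rw [symm_P_pow]; rfl
  rw [mass, transMass, show 2 * (N + 1) = 2 * N + 2 by ring, ← add_div, pow_succ' S.P N,
    Module.End.mul_apply, norm_sq_add_norm_sq, h, expect, ← Complex.ofReal_pow,
    Complex.div_ofReal_re]

theorem mass_nonneg (N n : ℕ) : 0 ≤ q.mass N n :=
  div_nonneg (sq_nonneg _) ((even_two_mul N).pow_nonneg _)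

theorem transMass_nonneg (N n : ℕ) : 0 ≤ q.transMass N n :=
  div_nonneg (sq_nonneg _) (((even_two_mul N).add even_two).pow_nonneg _)

theorem expect_conj_pow {f : Module.End ℂ E} (hf : ⁅S.P, f⁆ = 0) (N n : ℕ) :
    q.expect (2 * N) (f * S.P ^ (2 * N)) n
      = inner ℂ ((S.P ^ N) (q.u n)) (f ((S.P ^ N) (q.u n))) / (q.lam n : ℂ) ^ (2 * N) := by
  have h : Commute (S.P ^ N) f := Commute.pow_left (by
    rw [Ring.lie_def, sub_eq_zero] at hf; exact hf) N
  rw [expect, two_mul, pow_add, ← mul_assoc, ← h.eq, mul_assoc, Module.End.mul_apply,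
    Module.End.mul_apply, ← symm_P_pow, ← two_mul]

theorem norm_inner_apply_le {f : Module.End ℂ E} {C : ℝ} (hC : ∀ v, ‖f v‖ ≤ C * ‖v‖) (x y : E) :
    ‖inner ℂ x (f y)‖ ≤ C * (‖x‖ * ‖y‖) :=
  (norm_inner_le_norm _ _).trans <| by
    rw [mul_left_comm]; exact mul_le_mul_of_nonneg_left (hC y) (norm_nonneg x)

theorem exists_tendsto_mass {l : Ultrafilter ℕ} (hl : ↑l ≤ (atTop : Filter ℕ)) (N : ℕ) :
    ∃ m : ℝ, Tendsto (q.mass N) l (𝓝 m) ∧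
      Tendsto (fun n => q.mass (N + 1) n + q.transMass N n) l (𝓝 m) := by
  have hX := P_pow_mem (S := S) (2 * N)
  obtain ⟨z, hz⟩ := q.exists_tendsto_expect hl hX
  refine ⟨z.re, ?_, ?_⟩
  · rw [funext (q.mass_eq N)]
    exact (Complex.continuous_re.tendsto z).comp hz
  · rw [funext (q.mass_add_transMass N)]
    have h2 := q.tendsto_expect_mul_lap hl hX hz
    refine (Complex.continuous_re.tendsto z).comp (tendsto_expect_of_sub_mem ?_ h2)
    refine q.ord_le_null hl (2 * N + 1) (ord_le_succ _ ?_)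
    have e : S.P ^ N * (S.lap * S.P ^ N) - S.P ^ (2 * N) * S.lap
        = S.P ^ N * ⁅S.lap, S.P ^ N⁆ := by
      rw [two_mul, pow_add, Ring.lie_def]; noncomm_ring
    rw [e, two_mul]
    exact mul_mem (P_pow_mem N) (lie_lap_P_pow_mem N)

theorem sq_mul_le_of_recursion {β : ℕ → ℂ}
    (h : ∀ N : ℕ, (2 * N + 2 : ℂ) * β (N + 1) = (2 * N + 1 : ℂ) * β N) (N : ℕ) :
    ‖β N‖ ^ 2 * (N + 1) ≤ ‖β 0‖ ^ 2 := by
  induction N with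
  | zero => simp
  | succ N ih =>
    refine le_trans ?_ ih
    have h1 := congrArg (‖·‖) (h N)
    have e2 : (2 * N + 2 : ℂ) = ((2 * N + 2 : ℝ) : ℂ) := by push_cast; ring
    have e1 : (2 * N + 1 : ℂ) = ((2 * N + 1 : ℝ) : ℂ) := by push_cast; ring
    simp only [norm_mul, e1, e2, Complex.norm_real] at h1
    rw [Real.norm_of_nonneg (by positivity), Real.norm_of_nonneg (by positivity)] at h1
    have hx : ‖β (N + 1)‖ = (2 * N + 1) / (2 * N + 2) * ‖β N‖ := by
      field_simp; linarith
    rw [hx, mul_pow, div_pow]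
    push_cast
    have hN : (0 : ℝ) ≤ N := N.cast_nonneg
    have key : (2 * (N : ℝ) + 1) ^ 2 / (2 * N + 2) ^ 2 * (N + 1 + 1) ≤ N + 1 := by
      rw [div_mul_eq_mul_div, div_le_iff₀ (by positivity)]
      nlinarith
    calc _ = ‖β N‖ ^ 2 * ((2 * (N : ℝ) + 1) ^ 2 / (2 * N + 2) ^ 2 * (N + 1 + 1)) := by ring
      _ ≤ _ := mul_le_mul_of_nonneg_left key (sq_nonneg _)

theorem tendsto_zero_of_recursion {β : ℕ → ℂ}
    (h : ∀ N : ℕ, (2 * N + 2 : ℂ) * β (N + 1) = (2 * N + 1 : ℂ) * β N) :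
    Tendsto (fun N => ‖β N‖) atTop (𝓝 0) := by
  have h1 : Tendsto (fun N : ℕ => ‖β 0‖ ^ 2 * (1 / ((N : ℝ) + 1))) atTop (𝓝 0) := by
    simpa using tendsto_one_div_add_atTop_nhds_zero_nat.const_mul (‖β 0‖ ^ 2)
  have h2 : Tendsto (fun N : ℕ => ‖β N‖ ^ 2) atTop (𝓝 0) := by
    refine squeeze_zero (fun _ => sq_nonneg _) (fun N => ?_) h1
    rw [mul_one_div, le_div_iff₀ (by positivity)]
    exact sq_mul_le_of_recursion h N
  simpa [Real.sqrt_sq] using h2.sqrt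

/-- A sequence of masses whose drops control it up to an error tending to `0` tends to `0`. -/
theorem tendsto_zero_of_le_drop {m δ : ℕ → ℝ} {c C : ℝ} (hc : 0 < c) (hm : ∀ N, 0 ≤ m N)
    (hanti : Antitone m) (hδ : Tendsto δ atTop (𝓝 0))
    (h : ∀ N, c * m (N + 1) ≤ δ (N + 1) + C * (√(m (N + 1)) * √(m N - m (N + 1)))) :
    Tendsto m atTop (𝓝 0) := by
  have hL := tendsto_atTop_ciInf hanti ⟨0, by rintro _ ⟨N, rfl⟩; exact hm N⟩
  set L := ⨅ N, m N
  have hL1 := (tendsto_add_atTop_iff_nat 1).2 hL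
  have h0 : 0 ≤ L := ge_of_tendsto' hL hm
  have hR := ((tendsto_add_atTop_iff_nat 1).2 hδ).add
    ((hL1.sqrt.mul (hL.sub hL1).sqrt).const_mul C)
  have h1 := le_of_tendsto_of_tendsto' (hL1.const_mul c) hR h
  have h2 : L = 0 := by
    simp only [sub_self, Real.sqrt_zero, mul_zero, add_zero] at h1
    nlinarith
  rwa [h2] at hL

section Ultrafilter

variable {l : Ultrafilter ℕ} {b g : Module.End ℂ E} {c : ℝ}

theorem exists_tendsto_curvature (hl : ↑l ≤ (atTop : Filter ℕ)) :
    ∃ β : ℕ → ℂ, (∀ N, Tendsto (q.expect (2 * N) (⁅S.P, S.Q⁆ * S.P ^ (2 * N))) l (𝓝 (β N))) ∧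
      Tendsto (fun N => ‖β N‖) atTop (𝓝 0) := by
  have hm : ∀ N, ⁅S.P, S.Q⁆ * S.P ^ (2 * N) ∈ S.ord (2 * N) := fun N =>
    mult_mul_mem S.liePQ (P_pow_mem _)
  choose β hβ using fun N => q.exists_tendsto_expect hl (hm N)
  refine ⟨β, hβ, tendsto_zero_of_recursion fun N => ?_⟩
  have h1 := q.curvature_recursion hl N
  rw [mem_null, expect_sub, expect_smul, expect_smul] at h1
  have h2 := ((hβ (N + 1)).const_smul (2 * N + 2 : ℂ)).sub
    ((q.tendsto_expect_mul_lap hl (hm N) (hβ N)).const_smul (2 * N + 1 : ℂ))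
  have h3 := tendsto_nhds_unique h2 h1
  simpa [sub_eq_zero] using h3

theorem tendsto_mass_zero (hl : ↑l ≤ (atTop : Filter ℕ)) (hg : g ∈ S.mult)
    (hPb : ⁅S.P, b⁆ = 0) (hk : ⁅S.P, S.Q⁆ = Complex.I • b - ⁅S.P, g⁆) (hc : 0 < c)
    (hb : ∀ v, c * ‖v‖ ^ 2 ≤ (inner ℂ v (b v)).re) :
    ∃ m : ℕ → ℝ, (∀ N, Tendsto (q.mass N) l (𝓝 (m N))) ∧ Tendsto m atTop (𝓝 0) := by
  choose m hm hm' using q.exists_tendsto_mass hl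
  refine ⟨m, hm, ?_⟩
  obtain ⟨β, hβ, hβ0⟩ := q.exists_tendsto_curvature hl
  obtain ⟨C, hC⟩ := S.bounded _ (S.lieQ g hg)
  have ht : ∀ N, Tendsto (q.transMass N) l (𝓝 (m N - m (N + 1))) := fun N => by
    simpa using (hm' N).sub (hm (N + 1))
  have hm0 : ∀ N, 0 ≤ m N := fun N => ge_of_tendsto' (hm N) (q.mass_nonneg N)
  have hanti : Antitone m := antitone_nat_of_succ_le fun N =>
    sub_nonneg.1 (ge_of_tendsto' (ht N) (q.transMass_nonneg N))
  refine tendsto_zero_of_le_drop (C := C) hc hm0 hanti hβ0 fun N => ?_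
  have hF : S.P ^ (N + 1) * (⁅S.Q, g⁆ * (S.Q * S.P ^ N)) ∈ S.ord (2 * N + 2) :=
    ord_mono (by omega) (mul_mem (P_pow_mem (N + 1)) (mult_mul_mem (S.lieQ g hg)
      (Q_mul_mem (P_pow_mem N))))
  obtain ⟨γ, hγ⟩ := q.exists_tendsto_expect hl (neg_mem hF)
  have hγ' := tendsto_expect_of_sub_mem (q.lie_P_recursion hl hg N) hγ
  have hγle : ‖γ‖ ≤ C * (√(m (N + 1)) * √(m N - m (N + 1))) := by
    refine le_of_tendsto_of_tendsto hγ.norm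
      (((hm (N + 1)).sqrt.mul (ht N).sqrt).const_mul C) ?_
    filter_upwards [q.eventually_one_le hl] with n hn
    have hn0 : 0 < q.lam n := by linarith
    have e1 : √(q.mass (N + 1) n) = ‖(S.P ^ (N + 1)) (q.u n)‖ / q.lam n ^ (N + 1) := by
      rw [mass, mul_comm, pow_mul, ← div_pow, Real.sqrt_sq (by positivity)]
    have e2 : √(q.transMass N n) = ‖S.Q ((S.P ^ N) (q.u n))‖ / q.lam n ^ (N + 1) := by
      rw [transMass, show 2 * N + 2 = (N + 1) * 2 by ring, pow_mul, ← div_pow,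
        Real.sqrt_sq (by positivity)]
    rw [e1, e2, expect, norm_div, norm_pow, Complex.norm_real, Real.norm_of_nonneg hn0.le,
      LinearMap.neg_apply, inner_neg_right, norm_neg, Module.End.mul_apply, ← symm_P_pow,
      Module.End.mul_apply, Module.End.mul_apply, div_mul_div_comm, ← pow_add, ← mul_div_assoc,
      show N + 1 + (N + 1) = 2 * N + 2 by ring]
    gcongr
    exact norm_inner_apply_le hC _ _
  have hlim : c * m (N + 1) ≤ ‖β (N + 1)‖ + ‖γ‖ := by
    refine le_of_tendsto_of_tendsto ((hm (N + 1)).const_mul c) ((hβ (N + 1)).norm.add hγ'.norm) ?_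
    filter_upwards [q.eventually_one_le hl] with n hn
    have hn0 : 0 < q.lam n := by linarith
    have hb' : b = -Complex.I • (⁅S.P, S.Q⁆ + ⁅S.P, g⁆) := by
      rw [hk, sub_add_cancel, smul_smul]; simp
    have h1 : c * q.mass (N + 1) n ≤ ‖q.expect (2 * (N + 1)) (b * S.P ^ (2 * (N + 1))) n‖ := by
      refine le_trans ?_ (Complex.re_le_norm _)
      rw [q.expect_conj_pow hPb, mass, ← Complex.ofReal_pow, Complex.div_ofReal_re,
        ← mul_div_assoc]
      gcongr
      exact hb _
    refine h1.trans ?_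
    rw [hb', smul_mul_assoc, expect_smul, add_mul, expect_add, Pi.smul_apply, norm_smul, norm_neg,
      Complex.norm_I, one_mul]
    exact norm_add_le _ _
  linarith

theorem tendsto_expect_ultrafilter (hl : ↑l ≤ (atTop : Filter ℕ)) (hg : g ∈ S.mult)
    (hPb : ⁅S.P, b⁆ = 0) (hk : ⁅S.P, S.Q⁆ = Complex.I • b - ⁅S.P, g⁆) (hc : 0 < c)
    (hb : ∀ v, c * ‖v‖ ^ 2 ≤ (inner ℂ v (b v)).re) {e : Module.End ℂ E} {ν : ℂ}
    (he : e ∈ S.mult) (hPe : ⁅S.P, e⁆ = 0) (hQe : ⁅S.Q, e⁆ = ν • e) (hν : ν ≠ 0) :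
    Tendsto (fun n => inner ℂ (q.u n) (e (q.u n))) l (𝓝 0) := by
  obtain ⟨m, hm, hm0⟩ := q.tendsto_mass_zero hl hg hPb hk hc hb
  obtain ⟨C, hC⟩ := S.bounded e he
  obtain ⟨z, hz⟩ := q.exists_tendsto_expect hl (m := 0) he
  have hzN : ∀ N, Tendsto (q.expect (2 * N) (e * S.P ^ (2 * N))) l (𝓝 z) := by
    intro N
    induction N with
    | zero => simpa using hz
    | succ N ih =>
      refine tendsto_expect_of_sub_mem ?_
        (q.tendsto_expect_mul_lap hl (mult_mul_mem he (P_pow_mem _)) ih)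
      rw [← neg_sub]
      exact neg_mem (q.mul_pow_recursion hl he hPe hQe hν N)
  have hle : ∀ N, ‖z‖ ≤ C * m N := fun N => by
    refine le_of_tendsto_of_tendsto (hzN N).norm ((hm N).const_mul C) ?_
    filter_upwards [q.eventually_one_le hl] with n hn
    have hn0 : 0 < q.lam n := by linarith
    rw [q.expect_conj_pow hPe, norm_div, norm_pow, Complex.norm_real, Real.norm_of_nonneg hn0.le,
      mass, ← mul_div_assoc, sq]
    gcongr
    exact norm_inner_apply_le hC _ _
  have hz0 : z = 0 := by
    have := ge_of_tendsto' (hm0.const_mul C) hle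
    rwa [mul_zero, norm_le_zero_iff] at this
  rw [hz0] at hz
  have e0 : q.expect 0 e = fun n => inner ℂ (q.u n) (e (q.u n)) := by ext n; simp [expect]
  rwa [e0] at hz

end Ultrafilter

/-- Decorrelation of the eigenvectors from a multiplication operator `e` that commutes with `P` and
is an eigenvector of the adjoint action of `Q`, when the curvature is, up to a commutator with `P`,
bounded below by a positive constant. -/
theorem tendsto_inner_mult {b g : Module.End ℂ E} {c : ℝ} (hg : g ∈ S.mult)
    (hPb : ⁅S.P, b⁆ = 0) (hk : ⁅S.P, S.Q⁆ = Complex.I • b - ⁅S.P, g⁆) (hc : 0 < c)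
    (hb : ∀ v, c * ‖v‖ ^ 2 ≤ (inner ℂ v (b v)).re) {e : Module.End ℂ E} {ν : ℂ}
    (he : e ∈ S.mult) (hPe : ⁅S.P, e⁆ = 0) (hQe : ⁅S.Q, e⁆ = ν • e) (hν : ν ≠ 0) :
    Tendsto (fun n => inner ℂ (q.u n) (e (q.u n))) atTop (𝓝 0) :=
  tendsto_iff_ultrafilter _ _ _ |>.2 fun _ hl =>
    q.tendsto_expect_ultrafilter hl hg hPb hk hc hb he hPe hQe hν

end EigenSequence

section Sections

open ComplexConjugate

/-- The algebra of smooth functions on the torus. -/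
def smoothPeriodic : Subalgebra ℂ (Pt → ℂ) where
  carrier := {f | ContDiff ℝ (⊤ : ℕ∞) f ∧ IsPeriodic f}
  mul_mem' := fun ⟨hf, hf'⟩ ⟨hg, hg'⟩ => ⟨hf.mul hg, fun m x => by simp [hf' m x, hg' m x]⟩
  add_mem' := fun ⟨hf, hf'⟩ ⟨hg, hg'⟩ => ⟨hf.add hg, fun m x => by simp [hf' m x, hg' m x]⟩
  algebraMap_mem' := fun _ => ⟨contDiff_const, fun _ _ => rfl⟩

/-- The space `C^∞(𝕋², L)`, as a space of functions on the plane. -/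
def sectionSubmodule (B0 : ℝ) : Submodule ℂ (Pt → ℂ) where
  carrier := {u | MemCL B0 u}
  add_mem' := fun {u v} hu hv => ⟨hu.1.add hv.1, fun m => by
    conv_rhs => rw [← hu.2 m, ← hv.2 m]
    ext x; simp [magTrans, mul_add]⟩
  zero_mem' := ⟨contDiff_const, fun m => by ext x; simp [magTrans]⟩
  smul_mem' := fun c u hu => ⟨hu.1.const_smul c, fun m => by
    conv_rhs => rw [← hu.2 m]
    ext x; simp [magTrans, mul_left_comm]⟩

/-- The type of smooth sections of the line bundle with flux `B0`. -/
def Sect (B0 : ℝ) : Type := sectionSubmodule B0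

variable {B0 : ℝ}

namespace Sect

noncomputable instance : AddCommGroup (Sect B0) := inferInstanceAs (AddCommGroup (sectionSubmodule B0))

noncomputable instance : Module ℂ (Sect B0) := inferInstanceAs (Module ℂ (sectionSubmodule B0))

instance : CoeFun (Sect B0) fun _ => Pt → ℂ := ⟨fun u => u.1⟩

@[ext] theorem ext {u v : Sect B0} (h : ∀ x, u x = v x) : u = v := Subtype.ext (funext h)

@[simp] theorem add_apply (u v : Sect B0) (x : Pt) : (u + v) x = u x + v x := rfl

@[simp] theorem smul_apply (c : ℂ) (u : Sect B0) (x : Pt) : (c • u) x = c * u x := rfl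

theorem contDiff (u : Sect B0) : ContDiff ℝ (⊤ : ℕ∞) u := u.2.1

theorem continuous (u : Sect B0) : Continuous u := u.contDiff.continuous

theorem differentiable (u : Sect B0) : Differentiable ℝ u := u.contDiff.differentiable (by simp)

theorem magTrans_eq (u : Sect B0) (m : ℤ × ℤ) : magTrans B0 m u = u := u.2.2 m

theorem periodic_conj_mul (u v : Sect B0) : IsPeriodic fun x => conj (u x) * v x := by
  intro m x
  have h : ∀ w : Sect B0, w (x.1 + m.1, x.2 + m.2) =
      Complex.exp (((B0 / 2 * wedge ((m.1 : ℝ), (m.2 : ℝ)) (x.1 + m.1, x.2 + m.2) : ℝ) : ℂ)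
        * Complex.I) * w x := fun w => by
    conv_lhs => rw [← w.magTrans_eq m]
    simp only [magTrans, add_sub_cancel_right]
    congr 2
    push_cast; ring
  simp only [h, map_mul]
  rw [mul_mul_mul_comm, ← Complex.normSq_eq_conj_mul_self, Complex.normSq_eq_norm_sq,
    Complex.norm_exp_ofReal_mul_I]
  simp

theorem contDiff_conj_mul (u v : Sect B0) : ContDiff ℝ (⊤ : ℕ∞) fun x => conj (u x) * v x :=
  (Complex.conjCLE.contDiff.comp u.contDiff).mul v.contDiff

theorem isCompact_fund : IsCompact fund := isCompact_Icc

theorem _root_.integrableOn_fund {F : Type*} [NormedAddCommGroup F] {f : Pt → F}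
    (hf : Continuous f) : IntegrableOn f fund :=
  hf.continuousOn.integrableOn_compact isCompact_Icc

theorem integrableOn_conj_mul (u v : Sect B0) :
    IntegrableOn (fun x => conj (u x) * v x) fund :=
  integrableOn_fund (u.contDiff_conj_mul v).continuous

/-- The `L²` inner product on sections. -/
noncomputable abbrev core (B0 : ℝ) : PreInnerProductSpace.Core ℂ (Sect B0) where
  inner u v := ∫ x in fund, conj (u x) * v x
  conj_inner_symm u v := by
    rw [← integral_conj]; simp [mul_comm]
  re_inner_nonneg u := by
    have h : ∀ x, conj (u x) * u x = ((‖u x‖ ^ 2 : ℝ) : ℂ) := fun x => by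
      rw [← Complex.normSq_eq_conj_mul_self, Complex.normSq_eq_norm_sq]
    simp only [h, integral_complex_ofReal]
    exact integral_nonneg fun _ => by positivity
  add_left u v w := by
    simp only [add_apply, map_add, add_mul]
    exact integral_add (integrableOn_conj_mul _ _) (integrableOn_conj_mul _ _)
  smul_left u v c := by
    simp only [smul_apply, map_mul, mul_assoc]
    exact integral_const_mul _ _

noncomputable instance : SeminormedAddCommGroup (Sect B0) :=
  @InnerProductSpace.Core.toSeminormedAddCommGroup ℂ (Sect B0) _ _ _ (core B0)

noncomputable instance : InnerProductSpace ℂ (Sect B0) := InnerProductSpace.ofCore (core B0)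

theorem inner_def (u v : Sect B0) : inner ℂ u v = ∫ x in fund, conj (u x) * v x := rfl

theorem norm_sq_eq (u : Sect B0) : ‖u‖ ^ 2 = ∫ x in fund, ‖u x‖ ^ 2 := by
  have h : ∀ x, conj (u x) * u x = ((‖u x‖ ^ 2 : ℝ) : ℂ) := fun x => by
    rw [← Complex.normSq_eq_conj_mul_self, Complex.normSq_eq_norm_sq]
  have e : ((‖u‖ ^ 2 : ℝ) : ℂ) = ((∫ x in fund, ‖u x‖ ^ 2 : ℝ) : ℂ) := by
    rw [← integral_complex_ofReal, ← funext h, ← inner_def, inner_self_eq_norm_sq_to_K]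
    norm_cast
  exact_mod_cast e

/-- Multiplication of sections by smooth functions on the torus. -/
noncomputable def mulHom (B0 : ℝ) : smoothPeriodic →ₐ[ℂ] Module.End ℂ (Sect B0) where
  toFun f :=
    { toFun := fun u => ⟨fun x => f.1 x * u x, f.2.1.mul u.contDiff, fun m => by
        ext x
        have h1 : f.1 (x.1 - m.1, x.2 - m.2) = f.1 x := by
          rw [← f.2.2 m]; simp
        conv_rhs => rw [← u.magTrans_eq m]
        simp only [magTrans, h1]; ring⟩
      map_add' := fun u v => by ext x; exact mul_add _ _ _
      map_smul' := fun c u => by ext x; exact mul_left_comm _ _ _ }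
  map_one' := by ext u x; exact one_mul _
  map_mul' f g := by ext u x; exact mul_assoc _ _ _
  map_zero' := by ext u x; exact zero_mul _
  map_add' f g := by ext u x; exact add_mul _ _ _
  commutes' c := by ext u x; rfl

@[simp] theorem mulHom_apply (f : smoothPeriodic) (u : Sect B0) (x : Pt) :
    mulHom B0 f u x = f.1 x * u x := rfl

theorem norm_mulHom_le {f : smoothPeriodic} {C : ℝ} (hC : ∀ x ∈ fund, ‖f.1 x‖ ≤ C)
    (u : Sect B0) : ‖mulHom B0 f u‖ ≤ C * ‖u‖ := by
  have hC0 : 0 ≤ C := (norm_nonneg _).trans (hC (0, 0) (by simp [fund]))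
  refine (pow_le_pow_iff_left₀ (norm_nonneg _) (by positivity) two_ne_zero).1 ?_
  rw [mul_pow, norm_sq_eq, norm_sq_eq, ← integral_const_mul]
  refine setIntegral_mono_on (integrableOn_fund ?_) (integrableOn_fund ?_) measurableSet_Icc
    fun x hx => ?_
  · exact (mulHom B0 f u).continuous.norm.pow 2
  · exact (u.continuous.norm.pow 2).const_mul _
  · rw [mulHom_apply, norm_mul, mul_pow]
    gcongr
    exact hC x hx

theorem inner_mulHom (f : smoothPeriodic) (u : Sect B0) :
    inner ℂ u (mulHom B0 f u) = ∫ x in fund, f.1 x * ((‖u x‖ ^ 2 : ℝ) : ℂ) := by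
  rw [inner_def]
  congr 1 with x
  rw [mulHom_apply, mul_left_comm, ← Complex.normSq_eq_conj_mul_self, Complex.normSq_eq_norm_sq]

theorem mulHom_isSymmetric {f : smoothPeriodic} (hf : ∀ x, conj (f.1 x) = f.1 x) :
    (mulHom B0 f).IsSymmetric := fun u v => by
  rw [inner_def, inner_def]
  congr 1 with x
  simp only [mulHom_apply, map_mul, hf]; ring

theorem exists_norm_mulHom_le (f : smoothPeriodic) :
    ∃ C : ℝ, ∀ u : Sect B0, ‖mulHom B0 f u‖ ≤ C * ‖u‖ := by
  obtain ⟨C, hC⟩ := isCompact_fund.exists_bound_of_continuousOn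
    (f := f.1) f.2.1.continuous.continuousOn
  exact ⟨C, norm_mulHom_le hC⟩

theorem le_re_inner_mulHom {f : smoothPeriodic} {h : Pt → ℝ} (hf : ∀ x, f.1 x = h x) {c : ℝ}
    (hc : ∀ x ∈ fund, c ≤ h x) (u : Sect B0) :
    c * ‖u‖ ^ 2 ≤ (inner ℂ u (mulHom B0 f u)).re := by
  have hh : Continuous h := by
    have : h = fun x => (f.1 x).re := by ext x; simp [hf]
    rw [this]
    exact Complex.continuous_re.comp f.2.1.continuous
  have e : ∀ x, f.1 x * ((‖u x‖ ^ 2 : ℝ) : ℂ) = ((h x * ‖u x‖ ^ 2 : ℝ) : ℂ) := fun x => by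
    rw [hf]; push_cast; rfl
  rw [inner_mulHom]
  simp only [e]
  rw [integral_complex_ofReal, Complex.ofReal_re, norm_sq_eq, ← integral_const_mul]
  refine setIntegral_mono_on (integrableOn_fund ?_) (integrableOn_fund ?_) measurableSet_Icc
    fun x hx => ?_
  · exact (u.continuous.norm.pow 2).const_mul _
  · exact hh.mul (u.continuous.norm.pow 2)
  · gcongr
    exact hc x hx

end Sect

/-- The directional derivative of a smooth function on the torus. -/
noncomputable def torusDeriv (p : Pt) (f : smoothPeriodic) : smoothPeriodic :=
  ⟨fun x => fderiv ℝ f.1 x p, (f.2.1.fderiv_right (by simp)).clm_apply contDiff_const, fun m x => by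
    have h : (fun y : Pt => f.1 (y + ((m.1 : ℝ), (m.2 : ℝ)))) = f.1 := funext fun y => f.2.2 m y
    change fderiv ℝ f.1 (x + ((m.1 : ℝ), (m.2 : ℝ))) p = fderiv ℝ f.1 x p
    rw [← fderiv_comp_add_right, h]⟩

/-- The translation rule for a vector potential of a field with flux `B0`. -/
structure IsPotential (B0 : ℝ) (A : Pt → Pt) : Prop where
  contDiff : ContDiff ℝ (⊤ : ℕ∞) A
  translate : ∀ (m : ℤ × ℤ) (x : Pt),
    A (x.1 + m.1, x.2 + m.2) = A x + A0 B0 ((m.1 : ℝ), (m.2 : ℝ))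

/-- The covariant derivative `-i∂_p - p·(α + A)` of a function, in the direction `p`. -/
noncomputable def covDeriv (α : Pt) (A : Pt → Pt) (p : Pt) (u : Pt → ℂ) : Pt → ℂ := fun x =>
  -Complex.I * fderiv ℝ u x p - (dotp p (α + A x) : ℝ) * u x

theorem contDiff_dotp {A : Pt → Pt} (hA : ContDiff ℝ (⊤ : ℕ∞) A) (α p : Pt) :
    ContDiff ℝ (⊤ : ℕ∞) fun x => dotp p (α + A x) := by
  have h1 : ContDiff ℝ (⊤ : ℕ∞) fun x => (A x).1 := contDiff_fst.comp hA
  have h2 : ContDiff ℝ (⊤ : ℕ∞) fun x => (A x).2 := contDiff_snd.comp hA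
  simp only [dotp, Prod.fst_add, Prod.snd_add]
  fun_prop

theorem Sect.fderiv_apply (u : Sect B0) (m : ℤ × ℤ) (x p : Pt) :
    fderiv ℝ u x p =
      Complex.exp (Complex.I * (B0 / 2) * (wedge ((m.1 : ℝ), (m.2 : ℝ)) x : ℝ)) *
        (Complex.I * (B0 / 2) * (wedge ((m.1 : ℝ), (m.2 : ℝ)) p : ℝ) * u (x.1 - m.1, x.2 - m.2)
          + fderiv ℝ u (x.1 - m.1, x.2 - m.2) p) := by
  set w : Pt →L[ℝ] ℝ := (m.1 : ℝ) • ContinuousLinearMap.snd ℝ ℝ ℝ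
    - (m.2 : ℝ) • ContinuousLinearMap.fst ℝ ℝ ℝ
  have hw : ∀ y : Pt, wedge ((m.1 : ℝ), (m.2 : ℝ)) y = w y := fun y => by simp [w, wedge]
  have h1 : HasFDerivAt (fun y : Pt => ((wedge ((m.1 : ℝ), (m.2 : ℝ)) y : ℝ) : ℂ))
      (Complex.ofRealCLM.comp w) x := by
    simp only [hw]
    exact (Complex.ofRealCLM.comp w).hasFDerivAt
  have h2 := (h1.const_mul (Complex.I * (B0 / 2))).cexp
  have h3 : HasFDerivAt (fun y : Pt => u (y.1 - m.1, y.2 - m.2))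
      (fderiv ℝ u (x.1 - m.1, x.2 - m.2)) x := by
    have h := (u.differentiable (x - ((m.1 : ℝ), (m.2 : ℝ)))).hasFDerivAt
    exact h.comp x ((hasFDerivAt_id x).sub_const ((m.1 : ℝ), (m.2 : ℝ)))
  have h4 := (h2.mul h3).fderiv
  have h5 : (fun y : Pt => Complex.exp (Complex.I * (B0 / 2) *
      (wedge ((m.1 : ℝ), (m.2 : ℝ)) y : ℝ)) * u (y.1 - m.1, y.2 - m.2)) = u := u.magTrans_eq m
  rw [Pi.mul_def, h5] at h4
  rw [h4]
  simp [hw]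
  ring

theorem covDeriv_mem {A : Pt → Pt} (hA : IsPotential B0 A) (α p : Pt) (u : Sect B0) :
    MemCL B0 (covDeriv α A p u) := by
  refine ⟨?_, fun m => ?_⟩
  · exact (contDiff_const.mul ((u.contDiff.fderiv_right (by simp)).clm_apply contDiff_const)).sub
      ((Complex.ofRealCLM.contDiff.comp (contDiff_dotp hA.contDiff α p)).mul u.contDiff)
  · ext x
    have h1 : A x = A (x.1 - m.1, x.2 - m.2) + A0 B0 ((m.1 : ℝ), (m.2 : ℝ)) := by
      rw [← hA.translate]; simp
    have h2 := congrFun (u.magTrans_eq m) x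
    simp only [magTrans] at h2
    simp only [covDeriv, magTrans]
    rw [u.fderiv_apply m x p, ← h2, h1]
    simp only [dotp, A0, wedge, Prod.fst_add, Prod.snd_add]
    push_cast
    linear_combination (exp := 1) (B0 / 2 * (m.1 * p.2 - m.2 * p.1) *
      (Complex.exp (Complex.I * (B0 / 2) * ((m.1 : ℂ) * x.2 - m.2 * x.1)) *
        u (x.1 - m.1, x.2 - m.2))) * Complex.I_sq

/-- The magnetic momentum in the direction `p`, acting on sections. -/
noncomputable def momentum {A : Pt → Pt} (hA : IsPotential B0 A) (α p : Pt) :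
    Module.End ℂ (Sect B0) where
  toFun u := ⟨covDeriv α A p u, covDeriv_mem hA α p u⟩
  map_add' u v := by
    ext x
    change covDeriv α A p (u.1 + v.1) x = covDeriv α A p u.1 x + covDeriv α A p v.1 x
    simp only [covDeriv, fderiv_add (u.differentiable x) (v.differentiable x),
      _root_.add_apply, Pi.add_apply]
    ring
  map_smul' c u := by
    ext x
    change covDeriv α A p (c • u.1) x = c * covDeriv α A p u.1 x
    simp only [covDeriv, fderiv_const_smul (u.differentiable x), _root_.smul_apply,
      Pi.smul_apply, smul_eq_mul]
    ring

theorem momentum_apply {A : Pt → Pt} (hA : IsPotential B0 A) (α p : Pt) (u : Sect B0) (x : Pt) :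
    momentum hA α p u x = -Complex.I * fderiv ℝ u x p - (dotp p (α + A x) : ℝ) * u x := rfl

theorem lie_momentum_mulHom {A : Pt → Pt} (hA : IsPotential B0 A) (α p : Pt)
    (f : smoothPeriodic) :
    ⁅momentum hA α p, Sect.mulHom B0 f⁆
      = Sect.mulHom B0 ((-Complex.I) • torusDeriv p f) := by
  ext u x
  have h : fderiv ℝ (Sect.mulHom B0 f u) x p
      = f.1 x * fderiv ℝ u x p + u x * fderiv ℝ f.1 x p := by
    have h1 := (f.2.1.differentiable (by simp) x).hasFDerivAt.mul
      (u.differentiable x).hasFDerivAt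
    have h2 : (Sect.mulHom B0 f u).1 = f.1 * u.1 := rfl
    rw [h2, h1.fderiv]
    rfl
  rw [Ring.lie_def]
  change momentum hA α p (Sect.mulHom B0 f u) x - f.1 x * momentum hA α p u x
    = (-Complex.I * fderiv ℝ f.1 x p) * u x
  rw [momentum_apply, momentum_apply, h, Sect.mulHom_apply]
  ring

theorem integral_fund_fderiv_eq_zero (p : Pt) {w : Pt → ℂ} (hw : ContDiff ℝ (⊤ : ℕ∞) w)
    (hper : IsPeriodic w) : ∫ x in fund, fderiv ℝ w x p = 0 := by
  have hd : ∀ x, HasFDerivAt w (fderiv ℝ w x) x := fun x =>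
    (hw.differentiable (by simp) x).hasFDerivAt
  have h := integral_divergence_prod_Icc_of_hasFDerivAt_off_countable_of_le
    (fun x => (p.1 : ℂ) * w x) (fun x => (p.2 : ℂ) * w x) (fun x => (p.1 : ℂ) • fderiv ℝ w x)
    (fun x => (p.2 : ℂ) • fderiv ℝ w x) (0, 0) (1, 1) (by simp [Prod.le_def]) ∅ (by simp)
    (hw.continuous.const_mul _).continuousOn (hw.continuous.const_mul _).continuousOn
    (fun x _ => (hd x).const_mul _) (fun x _ => (hd x).const_mul _) ?_
  · have h1 : ∀ y : ℝ, w (1, y) = w (0, y) := fun y => by simpa using hper (1, 0) (0, y)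
    have h2 : ∀ y : ℝ, w (y, 1) = w (y, 0) := fun y => by simpa using hper (0, 1) (y, 0)
    simp only [h1, h2] at h
    simp only [sub_self, zero_add] at h
    rw [← h, fund]
    refine congrArg _ (funext fun x => ?_)
    have hp : p = p.1 • ((1 : ℝ), (0 : ℝ)) + p.2 • ((0 : ℝ), (1 : ℝ)) := by ext <;> simp
    conv_lhs => rw [hp, map_add, map_smul, map_smul]
    simp
  · refine integrableOn_fund (Continuous.add ?_ ?_)
    · exact ((hw.continuous_fderiv (by simp)).clm_apply continuous_const).const_mul _
    · exact ((hw.continuous_fderiv (by simp)).clm_apply continuous_const).const_mul _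

theorem momentum_isSymmetric {A : Pt → Pt} (hA : IsPotential B0 A) (α p : Pt) :
    (momentum hA α p).IsSymmetric := fun u v => by
  rw [← sub_eq_zero, Sect.inner_def, Sect.inner_def,
    ← integral_sub (Sect.integrableOn_conj_mul _ _) (Sect.integrableOn_conj_mul _ _)]
  have h : ∀ x, conj (momentum hA α p u x) * v x - conj (u x) * momentum hA α p v x
      = Complex.I * fderiv ℝ (fun y => conj (u y) * v y) x p := fun x => by
    have h1 : HasFDerivAt (fun y => conj (u y))
        ((Complex.conjCLE : ℂ →L[ℝ] ℂ).comp (fderiv ℝ u x)) x :=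
      (Complex.conjCLE : ℂ →L[ℝ] ℂ).hasFDerivAt.comp x (u.differentiable x).hasFDerivAt
    rw [show (fun y => conj (u y) * v y) = (fun y => conj (u y)) * v.1 from rfl,
      (h1.mul (v.differentiable x).hasFDerivAt).fderiv, momentum_apply, momentum_apply]
    simp
    ring
  simp only [h, integral_const_mul]
  rw [integral_fund_fderiv_eq_zero p (u.contDiff_conj_mul v) (u.periodic_conj_mul v), mul_zero]

end Sections

section Commutators

variable {B0 : ℝ} {A : Pt → Pt}

theorem fderiv_eq_of_fst_snd {F : Type*} [NormedAddCommGroup F] [NormedSpace ℝ F]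
    (L : Pt →L[ℝ] F) (p : Pt) : L p = p.1 • L (1, 0) + p.2 • L (0, 1) := by
  have hp : p = p.1 • ((1 : ℝ), (0 : ℝ)) + p.2 • ((0 : ℝ), (1 : ℝ)) := by ext <;> simp
  conv_lhs => rw [hp, map_add, map_smul, map_smul]

theorem momentum_eq (hA : IsPotential B0 A) (α p : Pt) :
    momentum hA α p = (p.1 : ℂ) • momentum hA α (1, 0) + (p.2 : ℂ) • momentum hA α (0, 1) := by
  ext u x
  change momentum hA α p u x
    = p.1 * momentum hA α (1, 0) u x + p.2 * momentum hA α (0, 1) u x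
  simp only [momentum_apply, fderiv_eq_of_fst_snd (fderiv ℝ u x) p, dotp, Complex.real_smul]
  push_cast
  ring

theorem fderiv_dotp_sub (hA : IsPotential B0 A) {B : Pt → ℝ}
    (hcurl : ∀ x, pdR1 (fun y => (A y).2) x - pdR2 (fun y => (A y).1) x = B x) (α p r x : Pt) :
    fderiv ℝ (fun y => dotp r (α + A y)) x p - fderiv ℝ (fun y => dotp p (α + A y)) x r
      = wedge p r * B x := by
  have hd := hA.contDiff.differentiable (by simp) x
  have h (s : Pt) : fderiv ℝ (fun y => dotp s (α + A y)) x
      = s.1 • fderiv ℝ (fun y => (A y).1) x + s.2 • fderiv ℝ (fun y => (A y).2) x := by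
    have e : (fun y => dotp s (α + A y))
        = fun y => (s.1 * (A y).1 + s.2 * (A y).2) + dotp s α := by
      ext y; simp [dotp]; ring
    rw [e, fderiv_add_const]
    exact ((hd.fst.hasFDerivAt.const_mul _).add (hd.snd.hasFDerivAt.const_mul _)).fderiv
  simp only [h, _root_.add_apply, _root_.smul_apply, smul_eq_mul]
  rw [fderiv_eq_of_fst_snd (fderiv ℝ (fun y => (A y).1) x) p,
    fderiv_eq_of_fst_snd (fderiv ℝ (fun y => (A y).1) x) r,
    fderiv_eq_of_fst_snd (fderiv ℝ (fun y => (A y).2) x) p,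
    fderiv_eq_of_fst_snd (fderiv ℝ (fun y => (A y).2) x) r, ← hcurl]
  simp only [pdR1, pdR2, wedge, smul_eq_mul]
  ring

/-- A real smooth function on the torus, as an element of the algebra of complex ones. -/
noncomputable def ofRealPeriodic {h : Pt → ℝ} (hs : ContDiff ℝ (⊤ : ℕ∞) h) (hp : IsPeriodic h) :
    smoothPeriodic :=
  ⟨fun x => (h x : ℂ), Complex.ofRealCLM.contDiff.comp hs, fun m x => by simp [hp m x]⟩

theorem lie_momentum_momentum (hA : IsPotential B0 A) {B : Pt → ℝ}
    (hBs : ContDiff ℝ (⊤ : ℕ∞) B) (hBp : IsPeriodic B)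
    (hcurl : ∀ x, pdR1 (fun y => (A y).2) x - pdR2 (fun y => (A y).1) x = B x) (α p r : Pt) :
    ⁅momentum hA α p, momentum hA α r⁆
      = Sect.mulHom B0 ((Complex.I * wedge p r) • ofRealPeriodic hBs hBp) := by
  ext u x
  have hd : ∀ s t : Pt, fderiv ℝ (momentum hA α s u) x t
      = -Complex.I * fderiv ℝ (fderiv ℝ u) x t s
        - (fderiv ℝ (fun y => dotp s (α + A y)) x t : ℝ) * u x
        - (dotp s (α + A x) : ℝ) * fderiv ℝ u x t := by
    intro s t
    have h1 : HasFDerivAt (fun y => fderiv ℝ u y s)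
        ((ContinuousLinearMap.apply ℝ ℂ s).comp (fderiv ℝ (fderiv ℝ u) x)) x :=
      (ContinuousLinearMap.apply ℝ ℂ s).hasFDerivAt.comp x
        ((u.contDiff.fderiv_right (m := (⊤ : ℕ∞)) (by simp)).differentiable
          (by simp) x).hasFDerivAt
    have h2 : HasFDerivAt (fun y => ((dotp s (α + A y) : ℝ) : ℂ))
        (Complex.ofRealCLM.comp (fderiv ℝ (fun y => dotp s (α + A y)) x)) x :=
      Complex.ofRealCLM.hasFDerivAt.comp x
        ((contDiff_dotp hA.contDiff α s).differentiable (by simp) x).hasFDerivAt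
    have h3 := (h1.const_mul (-Complex.I)).sub (h2.mul (u.differentiable x).hasFDerivAt)
    have h4 : (momentum hA α s u).1 = fun y => -Complex.I * fderiv ℝ u y s
      - (dotp s (α + A y) : ℝ) * u y := rfl
    rw [h4]
    refine (congrArg (fun L : Pt →L[ℝ] ℂ => L t) h3.fderiv).trans ?_
    simp
    ring
  have hsymm : fderiv ℝ (fderiv ℝ u) x p r = fderiv ℝ (fderiv ℝ u) x r p :=
    u.contDiff.contDiffAt.isSymmSndFDerivAt
      (by rw [minSmoothness_of_isRCLikeNormedField]; exact WithTop.coe_le_coe.2 (le_top : (2 : ℕ∞) ≤ ⊤)) p r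
  have hc : ((fderiv ℝ (fun y => dotp r (α + A y)) x p : ℝ) : ℂ)
      - ((fderiv ℝ (fun y => dotp p (α + A y)) x r : ℝ) : ℂ) = (wedge p r : ℝ) * (B x : ℝ) := by
    rw [← Complex.ofReal_sub, fderiv_dotp_sub hA hcurl, Complex.ofReal_mul]
  rw [Ring.lie_def]
  change momentum hA α p (momentum hA α r u) x - momentum hA α r (momentum hA α p u) x
    = ((Complex.I * wedge p r) * (B x : ℝ)) * u x
  rw [momentum_apply hA α p, momentum_apply hA α r (momentum hA α p u), hd, hd, momentum_apply,
    momentum_apply, hsymm]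
  linear_combination (Complex.I * u x) * hc

/-- The momentum algebra of sections in the orthogonal directions `p` and `r`. -/
noncomputable def magneticAlgebra (hA : IsPotential B0 A) {B : Pt → ℝ}
    (hBs : ContDiff ℝ (⊤ : ℕ∞) B) (hBp : IsPeriodic B)
    (hcurl : ∀ x, pdR1 (fun y => (A y).2) x - pdR2 (fun y => (A y).1) x = B x) (α p r : Pt) :
    MomentumAlgebra (Sect B0) where
  mult := (Sect.mulHom B0).range
  P := momentum hA α p
  Q := momentum hA α r
  mult_comm := by
    rintro _ ⟨f, rfl⟩ _ ⟨g, rfl⟩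
    simp only [← map_mul, mul_comm]
  bounded := by
    rintro _ ⟨f, rfl⟩
    exact Sect.exists_norm_mulHom_le f
  symmP := momentum_isSymmetric hA α p
  symmQ := momentum_isSymmetric hA α r
  lieP := by
    rintro _ ⟨f, rfl⟩
    exact ⟨_, (lie_momentum_mulHom hA α p f).symm⟩
  lieQ := by
    rintro _ ⟨f, rfl⟩
    exact ⟨_, (lie_momentum_mulHom hA α r f).symm⟩
  liePQ := ⟨_, (lie_momentum_momentum hA hBs hBp hcurl α p r).symm⟩

end Commutators

section Orbits

/-- The average of `f` along the segment from `x` to `x + p`, with weight `ω`. -/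
noncomputable def segmentAverage {F : Type*} [NormedAddCommGroup F] [NormedSpace ℝ F] (ω : ℝ → ℝ)
    (p : Pt) (f : Pt → F) (x : Pt) : F :=
  ∫ t in (0 : ℝ)..1, ω t • f (x + t • p)

variable {F : Type} [NormedAddCommGroup F] [NormedSpace ℝ F] {ω : ℝ → ℝ} {p : Pt}

theorem hasFDerivAt_segmentAverage (hω : Continuous ω) {f : Pt → F} (hf : ContDiff ℝ 1 f)
    (x : Pt) :
    HasFDerivAt (segmentAverage ω p f) (segmentAverage ω p (fderiv ℝ f) x) x := by
  have hf' := hf.continuous_fderiv one_ne_zero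
  have hc : Continuous fun y : Pt × ℝ => ω y.2 • fderiv ℝ f (y.1 + y.2 • p) := by fun_prop
  have hc0 : Continuous fun y : Pt × ℝ => ω y.2 • f (y.1 + y.2 • p) := by
    have := hf.continuous
    fun_prop
  obtain ⟨C, hC⟩ := ((isCompact_closedBall x 1).prod (isCompact_Icc (a := (0 : ℝ)) (b := 1)))
    |>.exists_bound_of_continuousOn hc.continuousOn
  refine (intervalIntegral.hasFDerivAt_integral_of_dominated_of_fderiv_le
    (F' := fun y t => ω t • fderiv ℝ f (y + t • p)) (bound := fun _ => C)
    (Metric.ball_mem_nhds x one_pos) ?_ ?_ ?_ ?_ ?_ ?_)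
  · exact Eventually.of_forall fun y =>
      (hc0.comp (Continuous.prodMk_right y)).aestronglyMeasurable
  · exact (hc0.comp (Continuous.prodMk_right x)).intervalIntegrable _ _
  · exact (hc.comp (Continuous.prodMk_right x)).aestronglyMeasurable
  · refine Eventually.of_forall fun t ht y hy => hC (y, t) ⟨Metric.ball_subset_closedBall hy, ?_⟩
    rw [Set.uIoc_of_le zero_le_one] at ht
    exact Set.Ioc_subset_Icc_self ht
  · exact intervalIntegrable_const
  · refine Eventually.of_forall fun t _ y _ => ?_
    have h1 := (hf.differentiable one_ne_zero (y + t • p)).hasFDerivAt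
    exact (h1.comp y ((hasFDerivAt_id y).add_const (t • p))).const_smul (ω t)

theorem contDiff_segmentAverage_nat (hω : Continuous ω) (n : ℕ) {f : Pt → F}
    (hf : ContDiff ℝ (n + 1 : ℕ) f) : ContDiff ℝ n (segmentAverage ω p f) := by
  induction n generalizing F with
  | zero =>
    have h := hasFDerivAt_segmentAverage (p := p) hω (hf.of_le (by simp))
    exact contDiff_zero.2 (continuous_iff_continuousAt.2 fun x => (h x).continuousAt)
  | succ n ih =>
    have h := hasFDerivAt_segmentAverage (p := p) hω (hf.of_le (by simp))
    push_cast
    rw [contDiff_succ_iff_hasFDerivAt]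
    exact ⟨_, ih (hf.fderiv_right (by simp)), h⟩

theorem contDiff_segmentAverage (hω : Continuous ω) {f : Pt → F}
    (hf : ContDiff ℝ (⊤ : ℕ∞) f) : ContDiff ℝ (⊤ : ℕ∞) (segmentAverage ω p f) :=
  contDiff_infty.2 fun n => contDiff_segmentAverage_nat hω n (hf.of_le (by exact_mod_cast le_top))

theorem IsPeriodic.segmentAverage {f : Pt → F} (hf : IsPeriodic f) :
    IsPeriodic (segmentAverage ω p f) := fun m x => by
  unfold _root_.segmentAverage
  congr 1 with t
  rw [← hf m (x + t • p)]
  congr 2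
  ext <;> simp <;> ring

theorem hasDerivAt_orbit {f : Pt → ℝ} (hf : ContDiff ℝ 1 f) (x : Pt) (t : ℝ) :
    HasDerivAt (fun s : ℝ => f (x + s • p)) (fderiv ℝ f (x + t • p) p) t := by
  have h1 : HasDerivAt (fun s : ℝ => x + s • p) p t := by
    simpa using ((hasDerivAt_id t).smul_const p).const_add x
  exact (hf.differentiable one_ne_zero _).hasFDerivAt.comp_hasDerivAt t h1

theorem fderiv_segmentAverage_apply (hω : Continuous ω) {f : Pt → ℝ} (hf : ContDiff ℝ 1 f)
    (x : Pt) : fderiv ℝ (segmentAverage ω p f) x p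
      = ∫ t in (0 : ℝ)..1, ω t * fderiv ℝ f (x + t • p) p := by
  rw [(hasFDerivAt_segmentAverage hω hf x).fderiv, segmentAverage,
    ContinuousLinearMap.intervalIntegral_apply]
  · rfl
  · have := hf.continuous_fderiv one_ne_zero
    exact Continuous.intervalIntegrable (by fun_prop) _ _

/-- The mean of a function along a closed orbit is invariant. -/
theorem fderiv_segmentAverage_one {f : Pt → ℝ} (hf : ContDiff ℝ 1 f) {x : Pt}
    (hx : f (x + p) = f x) : fderiv ℝ (segmentAverage (fun _ => 1) p f) x p = 0 := by
  have := hf.continuous_fderiv one_ne_zero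
  rw [fderiv_segmentAverage_apply continuous_const hf]
  simp only [one_mul]
  rw [intervalIntegral.integral_eq_sub_of_hasDerivAt (fun t _ => hasDerivAt_orbit hf x t)
    (Continuous.intervalIntegrable (by fun_prop) _ _)]
  simp [hx]

/-- The weight `t` solves the cohomological equation along a closed orbit. -/
theorem fderiv_segmentAverage_id {f : Pt → ℝ} (hf : ContDiff ℝ 1 f) {x : Pt}
    (hx : f (x + p) = f x) : fderiv ℝ (segmentAverage (fun t => t) p f) x p
      = f x - segmentAverage (fun _ => 1) p f x := by
  have := hf.continuous_fderiv one_ne_zero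
  rw [fderiv_segmentAverage_apply continuous_id' hf,
    intervalIntegral.integral_mul_deriv_eq_deriv_mul (fun t _ => hasDerivAt_id' t)
      (fun t _ => hasDerivAt_orbit hf x t) intervalIntegrable_const
      (Continuous.intervalIntegrable (by fun_prop) _ _)]
  simp [hx, segmentAverage]

end Orbits

section ClosedOrbits

theorem segmentAverage_one_eq {f : Pt → ℝ} (hf : Continuous f) {p x : Pt}
    (hx : ∀ y, f (y + p) = f y) {N : ℝ} (hN : 0 < N) {L : ℝ}
    (hL : Tendsto (fun T : ℝ => (1 / T) * ∫ t in (0 : ℝ)..T, f (x + t • ((1 / N) • p))) atTop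
      (𝓝 L)) :
    segmentAverage (fun _ => 1) p f x = L := by
  have hper : Function.Periodic (fun s : ℝ => f (x + s • p)) 1 := fun s => by
    simp only
    rw [← hx (x + s • p), add_smul, one_smul, add_assoc]
  have hc : Continuous fun s : ℝ => f (x + s • p) := by fun_prop
  have hT : Tendsto (fun n : ℕ => (n : ℝ) * N) atTop atTop :=
    tendsto_natCast_atTop_atTop.atTop_mul_const hN
  refine tendsto_nhds_unique ?_ (hL.comp hT)
  refine tendsto_const_nhds.congr' ?_
  filter_upwards [eventually_gt_atTop 0] with n hn
  have hn' : (0 : ℝ) < n := by exact_mod_cast hn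
  have h1 := hper.intervalIntegral_add_zsmul_eq n 0 fun _ _ => hc.intervalIntegrable _ _
  have h2 : ∀ t : ℝ, t • ((1 / N) • p) = (t / N) • p := fun t => by
    rw [smul_smul, mul_one_div]
  simp only [Function.comp_apply, h2]
  rw [intervalIntegral.integral_comp_div (fun s => f (x + s • p)) hN.ne', zero_div,
    mul_div_cancel_right₀ _ hN.ne']
  simp only [zsmul_eq_mul, Int.cast_natCast, mul_one, zero_add] at h1
  rw [h1, segmentAverage, smul_eq_mul]
  simp only [one_smul]
  field_simp

end ClosedOrbits

section PlaneWaves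

/-- The character `x ↦ exp (2πi k·x)` of the torus. -/
noncomputable def planeWave (k : ℤ × ℤ) : smoothPeriodic :=
  ⟨fun x => Complex.exp (2 * π * Complex.I * (k.1 * x.1 + k.2 * x.2)), by
    have h1 : ContDiff ℝ (⊤ : ℕ∞) fun x : Pt => (x.1 : ℂ) :=
      Complex.ofRealCLM.contDiff.comp contDiff_fst
    have h2 : ContDiff ℝ (⊤ : ℕ∞) fun x : Pt => (x.2 : ℂ) :=
      Complex.ofRealCLM.contDiff.comp contDiff_snd
    exact (contDiff_const.mul ((contDiff_const.mul h1).add (contDiff_const.mul h2))).cexp,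
  fun m x => by
    rw [Complex.exp_eq_exp_iff_exists_int]
    exact ⟨k.1 * m.1 + k.2 * m.2, by push_cast; ring⟩⟩

theorem planeWave_apply (k : ℤ × ℤ) (x : Pt) :
    (planeWave k).1 x = Complex.exp (2 * π * Complex.I * (k.1 * x.1 + k.2 * x.2)) := rfl

theorem torusDeriv_planeWave (k : ℤ × ℤ) (p : Pt) :
    torusDeriv p (planeWave k)
      = (2 * π * Complex.I * (k.1 * p.1 + k.2 * p.2) : ℂ) • planeWave k := by
  ext x
  have h1 : HasFDerivAt (fun x : Pt => (x.1 : ℂ))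
      (Complex.ofRealCLM.comp (ContinuousLinearMap.fst ℝ ℝ ℝ)) x :=
    Complex.ofRealCLM.hasFDerivAt.comp x hasFDerivAt_fst
  have h2 : HasFDerivAt (fun x : Pt => (x.2 : ℂ))
      (Complex.ofRealCLM.comp (ContinuousLinearMap.snd ℝ ℝ ℝ)) x :=
    Complex.ofRealCLM.hasFDerivAt.comp x hasFDerivAt_snd
  have h3 := (((h1.const_mul (k.1 : ℂ)).add (h2.const_mul (k.2 : ℂ))).const_mul
    (2 * π * Complex.I)).cexp
  refine (congrArg (fun L : Pt →L[ℝ] ℂ => L p) h3.fderiv).trans ?_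
  change _ = (2 * π * Complex.I * (k.1 * p.1 + k.2 * p.2) : ℂ) * (planeWave k).1 x
  rw [planeWave_apply]
  simp
  ring

end PlaneWaves

section Eigensections

variable {B0 : ℝ} {A : Pt → Pt}

theorem momentum_mul_self_add (hA : IsPotential B0 A) (α : Pt) (k : ℤ × ℤ) :
    momentum hA α (-k.2, k.1) * momentum hA α (-k.2, k.1)
        + momentum hA α (-k.1, -k.2) * momentum hA α (-k.1, -k.2)
      = ((k.1 ^ 2 + k.2 ^ 2 : ℝ) : ℂ) • (momentum hA α (1, 0) * momentum hA α (1, 0)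
        + momentum hA α (0, 1) * momentum hA α (0, 1)) := by
  rw [momentum_eq hA α (-k.2, k.1), momentum_eq hA α (-k.1, -k.2)]
  simp only [mul_add, add_mul, smul_mul_assoc, mul_smul_comm]
  push_cast
  module

theorem momentum_sq_add_apply (hA : IsPotential B0 A) (α : Pt) (u : Sect B0) (x : Pt) :
    (momentum hA α (1, 0) * momentum hA α (1, 0)
        + momentum hA α (0, 1) * momentum hA α (0, 1)) u x = magLap α A u x := by
  have h1 : ∀ v : Sect B0, (momentum hA α (1, 0) v).1 = Dop1 α A v := fun v => by
    ext y; simp [momentum_apply, Dop1, pd1, dotp]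
  have h2 : ∀ v : Sect B0, (momentum hA α (0, 1) v).1 = Dop2 α A v := fun v => by
    ext y; simp [momentum_apply, Dop2, pd2, dotp]
  change (momentum hA α (1, 0) (momentum hA α (1, 0) u)).1 x
    + (momentum hA α (0, 1) (momentum hA α (0, 1) u)).1 x = _
  rw [h1, h1, h2, h2]
  rfl

theorem torusDeriv_smul (p : Pt) (c : ℂ) (f : smoothPeriodic) :
    torusDeriv p (c • f) = c • torusDeriv p f := by
  ext x
  change fderiv ℝ (c • f.1) x p = c • fderiv ℝ f.1 x p
  rw [fderiv_const_smul (f.2.1.differentiable (by simp) x)]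
  rfl

theorem exists_pos_le_of_pos {f : Pt → ℝ} (hf : Continuous f) (h : ∀ x, 0 < f x) :
    ∃ c : ℝ, 0 < c ∧ ∀ x ∈ fund, c ≤ f x := by
  obtain ⟨x, -, hx⟩ := Sect.isCompact_fund.exists_isMinOn ⟨(0, 0), by simp [fund]⟩
    hf.continuousOn
  exact ⟨f x, h x, hx⟩

/-- Eigensections decorrelate from every nontrivial character of the torus. -/
theorem tendsto_integral_planeWave (hA : IsPotential B0 A) {B : Pt → ℝ}
    (hBs : ContDiff ℝ (⊤ : ℕ∞) B) (hBp : IsPeriodic B)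
    (hcurl : ∀ x, pdR1 (fun y => (A y).2) x - pdR2 (fun y => (A y).1) x = B x)
    {Binf : Pt → Pt → ℝ}
    (hBinf : ∀ x θ : Pt, Tendsto (fun T : ℝ => (1 / T) * ∫ t in (0 : ℝ)..T, B (x + t • θ))
      atTop (𝓝 (Binf x θ)))
    (hpos : ∀ x θ : Pt, θ.1 ^ 2 + θ.2 ^ 2 = 1 → 0 < Binf x θ)
    {V : Pt → ℝ} (hVs : ContDiff ℝ (⊤ : ℕ∞) V) (hVp : IsPeriodic V) (α : Pt)
    {lam : ℕ → ℝ} (hlam : Tendsto lam atTop atTop) {u : ℕ → Sect B0}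
    (heig : ∀ n x, magLap α A (u n) x + (V x : ℂ) * u n x = ((lam n ^ 2 : ℝ) : ℂ) * u n x)
    (hnorm : ∀ n, ‖u n‖ = 1) {k : ℤ × ℤ} (hk : k ≠ 0) :
    Tendsto (fun n => ∫ x in fund, (planeWave k).1 x * ((‖u n x‖ ^ 2 : ℝ) : ℂ)) atTop (𝓝 0) := by
  set p : Pt := (-k.2, k.1) with hp
  set r : Pt := (-k.1, -k.2) with hr
  set κ : ℝ := k.1 ^ 2 + k.2 ^ 2 with hκ
  have hκ0 : 0 < κ := by
    rcases Prod.ext_iff.not.1 hk |> not_and_or.1 with h | h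
    · have : (k.1 : ℝ) ≠ 0 := by exact_mod_cast h
      positivity
    · have : (k.2 : ℝ) ≠ 0 := by exact_mod_cast h
      positivity
  have hwedge : wedge p r = κ := by simp only [wedge, hp, hr, hκ]; ring
  have hBx : ∀ x, B (x + p) = B x := fun x => by
    have h := hBp (-k.2, k.1) x
    push_cast at h
    exact h
  have hB1 : ContDiff ℝ 1 B := hBs.of_le (by exact_mod_cast le_top)
  have hms := contDiff_segmentAverage (ω := fun _ => 1) (p := p) continuous_const hBs
  have hgs := contDiff_segmentAverage (ω := fun t => t) (p := p) continuous_id' hBs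
  set bm := ofRealPeriodic hms hBp.segmentAverage
  set bg := ofRealPeriodic hgs hBp.segmentAverage
  obtain ⟨c, hc, hcm⟩ := exists_pos_le_of_pos hms.continuous fun x => by
    rw [segmentAverage_one_eq hB1.continuous hBx (Real.sqrt_pos.2 hκ0) (hBinf x _)]
    refine hpos x _ ?_
    simp only [Prod.smul_fst, Prod.smul_snd, smul_eq_mul, mul_pow, div_pow, one_pow,
      Real.sq_sqrt hκ0.le, hp]
    rw [← mul_add, neg_sq, add_comm, ← hκ, one_div_mul_cancel hκ0.ne']
  have htd : ∀ {h : Pt → ℝ} (hs : ContDiff ℝ (⊤ : ℕ∞) h) (hh : IsPeriodic h) (x : Pt),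
      (torusDeriv p (ofRealPeriodic hs hh)).1 x = (fderiv ℝ h x p : ℝ) := fun hs hh x => by
    have h2 := Complex.ofRealCLM.hasFDerivAt.comp x (hs.differentiable (by simp) x).hasFDerivAt
    exact (congrArg (fun L : Pt →L[ℝ] ℂ => L p) h2.fderiv)
  have hdm : torusDeriv p bm = 0 := by
    ext x
    rw [htd, fderiv_segmentAverage_one hB1 (hBx x)]
    simp
  have hdg : torusDeriv p bg = ofRealPeriodic hBs hBp - bm := by
    ext x
    rw [htd, fderiv_segmentAverage_id hB1 (hBx x), Complex.ofReal_sub]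
    rfl
  let S := magneticAlgebra hA hBs hBp hcurl α p r
  let q : EigenSequence S :=
    { W := Sect.mulHom B0 ((κ : ℂ) • ofRealPeriodic hVs hVp)
      W_mem := ⟨_, rfl⟩
      W_symm := Sect.mulHom_isSymmetric fun x => by
        change (starRingEnd ℂ) ((κ : ℂ) * (V x : ℂ)) = (κ : ℂ) * (V x : ℂ)
        rw [map_mul, Complex.conj_ofReal, Complex.conj_ofReal]
      lam := fun n => √κ * lam n
      lam_tendsto := hlam.const_mul_atTop (Real.sqrt_pos.2 hκ0)
      u := u
      norm_u := hnorm
      eigen := fun n => by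
        have h1 : S.lap = (κ : ℂ) • (momentum hA α (1, 0) * momentum hA α (1, 0)
          + momentum hA α (0, 1) * momentum hA α (0, 1)) := momentum_mul_self_add hA α k
        rw [h1]
        ext x
        have h2 := momentum_sq_add_apply hA α (u n) x
        have h3 := heig n x
        rw [← h2] at h3
        have h4 : ((√κ * lam n : ℝ) : ℂ) ^ 2 = (κ : ℂ) * ((lam n ^ 2 : ℝ) : ℂ) := by
          rw [← Complex.ofReal_pow, mul_pow, Real.sq_sqrt hκ0.le, Complex.ofReal_mul]
        rw [h4, Sect.smul_apply, mul_assoc, ← h3]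
        change (κ : ℂ) * _ + ((κ : ℂ) * (V x : ℂ)) * u n x = _
        ring }
  have key := q.tendsto_inner_mult (b := Sect.mulHom B0 ((κ : ℂ) • bm))
    (g := Sect.mulHom B0 ((κ : ℂ) • bg)) (c := κ * c) (e := Sect.mulHom B0 (planeWave k))
    (ν := -(2 * π * κ : ℝ)) ⟨_, rfl⟩ ?_ ?_ (by positivity) (fun v => ?_) ⟨_, rfl⟩ ?_ ?_ ?_
  · simpa only [Sect.inner_mulHom] using key
  · change ⁅momentum hA α p, _⁆ = 0
    rw [lie_momentum_mulHom, torusDeriv_smul, hdm, smul_zero, smul_zero, map_zero]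
  · change ⁅momentum hA α p, momentum hA α r⁆ = _ - ⁅momentum hA α p, _⁆
    rw [lie_momentum_mulHom, torusDeriv_smul, hdg, lie_momentum_momentum hA hBs hBp hcurl, hwedge,
      ← map_smul, ← map_sub]
    congr 1
    module
  · rw [mul_assoc, map_smul, LinearMap.smul_apply, inner_smul_right, Complex.re_ofReal_mul]
    gcongr
    exact Sect.le_re_inner_mulHom (fun x => rfl) hcm v
  · change ⁅momentum hA α p, _⁆ = 0
    rw [lie_momentum_mulHom, torusDeriv_planeWave]
    simp only [hp]
    push_cast
    rw [show (k.1 : ℂ) * -k.2 + k.2 * k.1 = 0 by ring, mul_zero, zero_smul, smul_zero, map_zero]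
  · change ⁅momentum hA α r, _⁆ = _
    rw [lie_momentum_mulHom, torusDeriv_planeWave, ← map_smul, smul_smul]
    congr 2
    simp only [hr, hκ]
    push_cast
    linear_combination (2 * π * ((k.1 : ℂ) ^ 2 + (k.2 : ℂ) ^ 2)) * Complex.I_sq
  · rw [neg_ne_zero, Complex.ofReal_ne_zero]
    positivity

end Eigensections

section Density

/-- The covering map from the plane to the torus. -/
noncomputable def toTorus (x : Pt) : UnitAddTorus (Fin 2) := ![(x.1 : UnitAddCircle), x.2]

theorem continuous_toTorus : Continuous toTorus := by
  refine continuous_pi fun i => ?_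
  fin_cases i
  · exact (AddCircle.continuous_mk' 1).comp continuous_fst
  · exact (AddCircle.continuous_mk' 1).comp continuous_snd

theorem mFourier_toTorus (k : Fin 2 → ℤ) (x : Pt) :
    UnitAddTorus.mFourier k (toTorus x) = (planeWave (k 0, k 1)).1 x := by
  simp only [UnitAddTorus.mFourier, ContinuousMap.coe_mk, Fin.prod_univ_two, toTorus,
    Matrix.cons_val_zero, Matrix.cons_val_one, fourier_coe_apply, planeWave_apply,
    ← Complex.exp_add]
  congr 1
  push_cast
  ring

theorem exists_continuousMap_torus {a : Pt → ℂ} (ha : Continuous a) (hper : IsPeriodic a) :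
    ∃ f : C(UnitAddTorus (Fin 2), ℂ), ∀ x, f (toTorus x) = a x := by
  let out : UnitAddCircle → ℝ := Function.surjInv QuotientAddGroup.mk_surjective
  have hout : ∀ t : ℝ, ∃ n : ℤ, out t = t + n := fun t => by
    have h : ((out t : ℝ) : UnitAddCircle) = t := Function.surjInv_eq _ _
    obtain ⟨n, hn⟩ := AddSubgroup.mem_zmultiples_iff.1 (QuotientAddGroup.eq.1 h.symm)
    refine ⟨n, ?_⟩
    simp only [zsmul_eq_mul, mul_one] at hn
    linarith
  have h : ∀ s t : ℝ, a (out s, out t) = a (s, t) := fun s t => by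
    obtain ⟨m, hm⟩ := hout s
    obtain ⟨n, hn⟩ := hout t
    rw [hm, hn]
    exact hper (m, n) (s, t)
  refine ⟨⟨fun y => a (out (y 0), out (y 1)), ?_⟩, fun x => h x.1 x.2⟩
  have hq : IsOpenQuotientMap (Pi.map fun (_ : Fin 2) (t : ℝ) => (t : UnitAddCircle)) :=
    IsOpenQuotientMap.piMap fun _ => QuotientAddGroup.isOpenQuotientMap_mk
  rw [hq.isQuotientMap.continuous_iff]
  have e : ((fun y : UnitAddTorus (Fin 2) => a (out (y 0), out (y 1))) ∘
      Pi.map fun (_ : Fin 2) (t : ℝ) => (t : UnitAddCircle)) = fun z => a (z 0, z 1) :=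
    funext fun z => h (z 0) (z 1)
  rw [e]
  fun_prop

theorem integral_planeWave {k : ℤ × ℤ} (hk : k ≠ 0) : ∫ x in fund, (planeWave k).1 x = 0 := by
  have h := integral_fund_fderiv_eq_zero ((k.1 : ℝ), (k.2 : ℝ)) (planeWave k).2.1 (planeWave k).2.2
  have e : ∀ x, fderiv ℝ (planeWave k).1 x ((k.1 : ℝ), (k.2 : ℝ))
      = (2 * π * Complex.I * ((k.1 ^ 2 + k.2 ^ 2 : ℝ) : ℂ)) * (planeWave k).1 x := fun x => by
    refine (congrFun (congrArg Subtype.val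
      (torusDeriv_planeWave k ((k.1 : ℝ), (k.2 : ℝ)))) x).trans ?_
    change (_ : ℂ) * (planeWave k).1 x = _
    push_cast
    ring
  simp only [e, integral_const_mul] at h
  refine (mul_eq_zero.1 h).resolve_left ?_
  have hκ : (0 : ℝ) < k.1 ^ 2 + k.2 ^ 2 := by
    rcases Prod.ext_iff.not.1 hk |> not_and_or.1 with h | h
    · have : (k.1 : ℝ) ≠ 0 := by exact_mod_cast h
      positivity
    · have : (k.2 : ℝ) ≠ 0 := by exact_mod_cast h
      positivity
  exact mul_ne_zero (by simp [Real.pi_ne_zero]) (by exact_mod_cast hκ.ne')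

theorem volume_fund : volume.real fund = 1 := by
  rw [fund, Measure.real, ← Set.Icc_prod_Icc, Measure.volume_eq_prod, Measure.prod_prod]
  simp

/-- A sequence of continuous probability densities on the torus whose nontrivial Fourier
coefficients tend to zero equidistributes. -/
theorem tendsto_integral_mul_of_planeWave {w : ℕ → Pt → ℝ} (hw : ∀ n, Continuous (w n))
    (hw0 : ∀ n x, 0 ≤ w n x) (hw1 : ∀ n, ∫ x in fund, w n x = 1)
    (h : ∀ k ≠ 0, Tendsto (fun n => ∫ x in fund, (planeWave k).1 x * (w n x : ℂ)) atTop (𝓝 0))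
    {a : Pt → ℂ} (ha : Continuous a) (hper : IsPeriodic a) :
    Tendsto (fun n => ∫ x in fund, a x * (w n x : ℂ)) atTop (𝓝 (∫ x in fund, a x)) := by
  let D (f : C(UnitAddTorus (Fin 2), ℂ)) (n : ℕ) : ℂ :=
    ∫ x in fund, f (toTorus x) * ((w n x - 1 : ℝ) : ℂ)
  have hint (f : C(UnitAddTorus (Fin 2), ℂ)) (n : ℕ) :
      IntegrableOn (fun x => f (toTorus x) * ((w n x - 1 : ℝ) : ℂ)) fund :=
    integrableOn_fund ((f.continuous.comp continuous_toTorus).mul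
      (Complex.continuous_ofReal.comp ((hw n).sub continuous_const)))
  have hadd (f g n) : D (f + g) n = D f n + D g n := by
    simp only [D, ContinuousMap.add_apply, add_mul]
    exact integral_add (hint f n) (hint g n)
  have hsmul (c : ℂ) (f n) : D (c • f) n = c * D f n := by
    simp only [D, ContinuousMap.smul_apply, smul_eq_mul, mul_assoc]
    exact integral_const_mul _ _
  have hnorm (f n) : ‖D f n‖ ≤ 2 * ‖f‖ := by
    have h1 : IntegrableOn (fun x => ‖f‖ * (w n x + 1)) fund :=
      integrableOn_fund (((hw n).add continuous_const).const_mul _)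
    refine (norm_integral_le_of_norm_le h1 (ae_of_all _ fun x => ?_)).trans_eq ?_
    · rw [norm_mul, Complex.norm_real]
      gcongr
      · exact f.norm_coe_le_norm _
      · refine (norm_sub_le _ _).trans_eq ?_
        rw [Real.norm_of_nonneg (hw0 n x), norm_one]
    · rw [integral_const_mul, integral_add (integrableOn_fund (hw n))
        (integrableOn_fund continuous_const), hw1]
      simp [volume_fund]
      ring
  have hwave (k : Fin 2 → ℤ) : Tendsto (D (UnitAddTorus.mFourier k)) atTop (𝓝 0) := by
    have e : D (UnitAddTorus.mFourier k) = fun n =>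
        (∫ x in fund, (planeWave (k 0, k 1)).1 x * (w n x : ℂ))
          - ∫ x in fund, (planeWave (k 0, k 1)).1 x := by
      ext n
      have hc := (planeWave (k 0, k 1)).2.1.continuous
      have hi : IntegrableOn (fun x => (planeWave (k 0, k 1)).1 x * (w n x : ℂ)) fund :=
        integrableOn_fund (hc.mul (Complex.continuous_ofReal.comp (hw n)))
      rw [← integral_sub hi (integrableOn_fund hc)]
      simp only [D, mFourier_toTorus]
      congr 1 with x
      push_cast
      ring
    rw [e]
    by_cases hk : (k 0, k 1) = 0
    · have h1 : ∀ x, (planeWave 0).1 x = 1 := fun x => by simp [planeWave_apply]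
      simp only [hk, h1, one_mul, integral_complex_ofReal, hw1]
      simp [volume_fund]
    · simpa [integral_planeWave hk] using h _ hk
  have hspan (f) (hf : f ∈ Submodule.span ℂ (Set.range (UnitAddTorus.mFourier (d := Fin 2)))) :
      Tendsto (D f) atTop (𝓝 0) := by
    induction hf using Submodule.span_induction with
    | mem f hf => obtain ⟨k, rfl⟩ := hf; exact hwave k
    | zero =>
      have : D 0 = 0 := by ext n; simp [D]
      rw [this]; exact tendsto_const_nhds
    | add f g _ _ hf hg =>
      rw [funext (hadd f g)]; simpa using hf.add hg
    | smul c f _ hf =>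
      rw [funext (hsmul c f)]; simpa using hf.const_mul c
  have hall (f) : Tendsto (D f) atTop (𝓝 0) := by
    rw [Metric.tendsto_atTop]
    intro ε hε
    have hf : f ∈ closure (Submodule.span ℂ (Set.range (UnitAddTorus.mFourier (d := Fin 2))) :
        Set C(UnitAddTorus (Fin 2), ℂ)) := by
      rw [← Submodule.topologicalClosure_coe, UnitAddTorus.span_mFourier_closure_eq_top]
      trivial
    obtain ⟨g, hg, hfg⟩ := Metric.mem_closure_iff.1 hf (ε / 4) (by positivity)
    obtain ⟨N, hN⟩ := Metric.tendsto_atTop.1 (hspan g hg) (ε / 2) (by positivity)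
    refine ⟨N, fun n hn => ?_⟩
    have h1 := hN n hn
    have h2 := hnorm (f - g) n
    have h3 : D f n = D (f - g) n + D g n := by rw [← hadd, sub_add_cancel]
    rw [dist_eq_norm] at hfg
    rw [dist_zero_right] at h1 ⊢
    rw [h3]
    refine (norm_add_le _ _).trans_lt ?_
    linarith
  obtain ⟨f, hf⟩ := exists_continuousMap_torus ha hper
  have e : D f = fun n => (∫ x in fund, a x * (w n x : ℂ)) - ∫ x in fund, a x := by
    ext n
    have hi : IntegrableOn (fun x => a x * (w n x : ℂ)) fund :=
      integrableOn_fund (ha.mul (Complex.continuous_ofReal.comp (hw n)))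
    rw [← integral_sub hi (integrableOn_fund ha)]
    simp only [D, hf]
    congr 1 with x
    push_cast
    ring
  have := hall f
  rw [e] at this
  simpa using this.add_const (∫ x in fund, a x)

end Density

/-- Theorem 1.1, configuration-space part, of Morin–Rivière:
under the geometric control condition `B_∞ > 0`, eigenfunctions of `𝓛_α + V`
equidistribute on the torus. -/
theorem statement0
    (B : Pt → ℝ) (hBsm : ContDiff ℝ (⊤ : ℕ∞) B) (hBper : IsPeriodic B)
    (B0 : ℝ) (hB0 : B0 = ∫ x in fund, B x) (hflux : ∃ k : ℤ, B0 = 2 * π * k)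
    (Aper : Pt → Pt) (hApersm : ContDiff ℝ (⊤ : ℕ∞) Aper) (hAperper : IsPeriodic Aper)
    (A : Pt → Pt) (hA : ∀ x, A x = A0 B0 x + Aper x)
    (hcurl : ∀ x, pdR1 (fun y => (A y).2) x - pdR2 (fun y => (A y).1) x = B x)
    (Binf : Pt → Pt → ℝ)
    (hBinf : ∀ x θ : Pt, Tendsto (fun T : ℝ => (1 / T) * ∫ t in (0:ℝ)..T, B (x + t • θ))
      atTop (𝓝 (Binf x θ)))
    (hpos : ∀ x θ : Pt, θ.1 ^ 2 + θ.2 ^ 2 = 1 → 0 < Binf x θ)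
    (V : Pt → ℝ) (hVsm : ContDiff ℝ (⊤ : ℕ∞) V) (hVper : IsPeriodic V)
    (α : Pt)
    (lam : ℕ → ℝ) (hlampos : ∀ n, 0 < lam n) (hlam : Tendsto lam atTop atTop)
    (u : ℕ → Pt → ℂ) (hu : ∀ n, MemCL B0 (u n))
    (heig : ∀ n x, magLap α A (u n) x + (V x : ℂ) * u n x = ((lam n ^ 2 : ℝ) : ℂ) * u n x)
    (hnorm : ∀ n, ∫ x in fund, ‖u n x‖ ^ 2 = 1) :
    ∀ a : Pt → ℂ, ContDiff ℝ (⊤ : ℕ∞) a → IsPeriodic a →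
      Tendsto (fun n => ∫ x in fund, a x * ((‖u n x‖ ^ 2 : ℝ) : ℂ)) atTop
        (𝓝 (∫ x in fund, a x)) := by
  have hPot : IsPotential B0 A := by
    constructor
    · rw [funext hA]
      refine ContDiff.add ?_ hApersm
      unfold A0
      fun_prop
    · intro m x
      rw [hA, hA, hAperper m x]
      ext <;> simp [A0] <;> ring
  have hk : ∀ k ≠ 0, Tendsto (fun n => ∫ x in fund,
      (planeWave k).1 x * ((‖u n x‖ ^ 2 : ℝ) : ℂ)) atTop (𝓝 0) := fun k hk =>
    tendsto_integral_planeWave hPot hBsm hBper hcurl hBinf hpos hVsm hVper α hlam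
      (u := fun n => (⟨u n, hu n⟩ : Sect B0)) heig
      (fun n => (sq_eq_sq₀ (norm_nonneg _) zero_le_one).1
        ((Sect.norm_sq_eq _).trans ((hnorm n).trans (one_pow 2).symm))) hk
  exact fun a ha hper => tendsto_integral_mul_of_planeWave (w := fun n x => ‖u n x‖ ^ 2)
    (fun n => (hu n).1.continuous.norm.pow 2) (fun n x => sq_nonneg _) hnorm hk ha.continuous hper
end

section
/- Assume B̂₀ ∈ 2πℤ. For all h > 0, η ∈ 2πℤ², ζ ∈ ℝ², and m ∈ ℤ², the magnetic Weyl operator commutes with the magnetic translation: W_h^B(η,ζ) ∘ 𝒯_m^B = 𝒯_m^B ∘ W_h^B(η,ζ) as operators on complex-valued functions on ℝ². -/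
open MeasureTheory Filter Topology
open scoped Real ENNReal

/-- The magnetic Weyl operator
`(W_h^B(η,ζ)u)(x) = e^{(ihB̂₀/2)(ζ∧x)} e^{iη·(x+hζ/2)} u(x+hζ)`. -/
noncomputable def weyl (B0 h : ℝ) (η ζ : Pt) (u : Pt → ℂ) : Pt → ℂ := fun x =>
  Complex.exp (Complex.I * ((h * B0 / 2) : ℝ) * ((wedge ζ x : ℝ) : ℂ)) *
    Complex.exp (Complex.I * ((dotp η (x + (h / 2) • ζ) : ℝ) : ℂ)) *
    u (x + h • ζ)

/-- the magnetic Weyl operators commute with the magnetic translations. -/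
theorem statement10
    (B0 : ℝ) (hflux : ∃ k : ℤ, B0 = 2 * π * k) (h : ℝ) (hh : 0 < h)
    (η ζ : Pt) (hη : ∃ k : ℤ × ℤ, η = (2 * π * k.1, 2 * π * k.2))
    (m : ℤ × ℤ) (u : Pt → ℂ) :
    weyl B0 h η ζ (magTrans B0 m u) = magTrans B0 m (weyl B0 h η ζ u) := by
  obtain ⟨⟨k₁, k₂⟩, rfl⟩ := hη
  funext x
  have hpoint : (((x + h • ζ).1 - (m.1 : ℝ), (x + h • ζ).2 - (m.2 : ℝ)) : Pt) =
      (x.1 - (m.1 : ℝ), x.2 - (m.2 : ℝ)) + h • ζ := by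
    ext <;> simp only [Prod.fst_add, Prod.snd_add, Prod.smul_fst, Prod.smul_snd] <;> ring
  simp only [weyl, magTrans]
  rw [hpoint]
  simp only [← mul_assoc, ← Complex.exp_add]
  congr 1
  rw [Complex.exp_eq_exp_iff_exists_int]
  refine ⟨k₁ * m.1 + k₂ * m.2, ?_⟩
  simp only [wedge, dotp, Prod.fst_add, Prod.snd_add, Prod.smul_fst, Prod.smul_snd, smul_eq_mul]
  push_cast
  ring
end
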